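/- arXiv:2603.22240 — 5 statements merged into one kernel-verified Lean document; each statement's English description precedes it below -/
import Mathlib

section
/- Let d ≥ 1 be an integer, let T be a finite tree, and let P be a maximum-size collection of pairwise vertex-disjoint connected subgraphs of T, each on exactly d+1 vertices. Then the minimum size of a d-coc set of T equals |P|; in particular, every minimum d-coc set of T contains exactly one vertex of each graph of P. -/
namespace CocPaper

open SimpleGraph

variable {V : Type} {W : Type}

/-- `S` is a `d`-coc set of the subgraph of `G` induced on the vertex set `A`:
after deleting `S`, every connected component has at most `d` vertices. -/
def IsCocSetOn (G : SimpleGraph V) (A : Set V) (d : ℕ) (S : Set V) : Prop :=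
  ∀ c : (G.induce (A \ S)).ConnectedComponent, c.supp.ncard ≤ d

/-- The minimum size of a `d`-coc set of the subgraph of `G` induced on `A`. -/
noncomputable def cocOptOn (G : SimpleGraph V) (A : Set V) (d : ℕ) : ℕ :=
  sInf {m : ℕ | ∃ S : Set V, S ⊆ A ∧ IsCocSetOn G A d S ∧ S.ncard = m}

/-- `S` is a minimum `d`-coc set of the subgraph of `G` induced on `A`. -/
def IsMinCocSetOn (G : SimpleGraph V) (A : Set V) (d : ℕ) (S : Set V) : Prop :=
  S ⊆ A ∧ IsCocSetOn G A d S ∧ S.ncard = cocOptOn G A d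

/-- `X` is a `d`-blocking set of `G[A]`: no minimum `d`-coc set contains `X`. -/
def IsBlockingSetOn (G : SimpleGraph V) (A : Set V) (d : ℕ) (X : Set V) : Prop :=
  ∀ S : Set V, IsMinCocSetOn G A d S → ¬ X ⊆ S

/-- A minimal `d`-blocking set: a `d`-blocking set no proper subset of which is one. -/
def IsMinimalBlockingSetOn (G : SimpleGraph V) (A : Set V) (d : ℕ) (X : Set V) : Prop :=
  IsBlockingSetOn G A d X ∧ ∀ Y : Set V, Y ⊂ X → ¬ IsBlockingSetOn G A d Y

/-- `G` is (isomorphic to) a path graph, possibly empty. -/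
def IsPathGraph (G : SimpleGraph V) : Prop :=
  ∃ n : ℕ, Nonempty (G ≃g SimpleGraph.pathGraph n)

/-- A caterpillar: a tree such that deleting all vertices of degree one yields a
(possibly empty) path. -/
def IsCaterpillar (G : SimpleGraph V) : Prop :=
  G.IsTree ∧ IsPathGraph (G.induce {v : V | (G.neighborSet v).ncard ≠ 1})

/-- A caterpillar forest: every connected component is a caterpillar. -/
def IsCaterpillarForest (G : SimpleGraph V) : Prop :=
  ∀ c : G.ConnectedComponent, IsCaterpillar (G.induce c.supp)

/-- `G` is (isomorphic to) a cycle graph. -/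
def IsCycleGraph (G : SimpleGraph V) : Prop :=
  ∃ n : ℕ, 3 ≤ n ∧ Nonempty (G ≃g SimpleGraph.cycleGraph n)

/-- A connected subgraph of `G` which is a caterpillar, equipped with a fixed
nonempty spine listed in left-to-right order: the spine is a path in `G` inside
`verts`, and every vertex of `verts` off the spine has degree one in the subgraph. -/
structure SubCaterpillar (G : SimpleGraph V) where
  verts : Set V
  n : ℕ
  npos : 0 < n
  spine : Fin n → V
  spineMem : ∀ i, spine i ∈ verts
  spineInj : Function.Injective spine
  spineAdj : ∀ (i : ℕ) (h : i + 1 < n),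
    G.Adj (spine ⟨i, Nat.lt_of_succ_lt h⟩) (spine ⟨i + 1, h⟩)
  isTree : (G.induce verts).IsTree
  pendant : ∀ v ∈ verts, v ∉ Set.range spine → {w : V | w ∈ verts ∧ G.Adj v w}.ncard = 1

/-- The spine position of a vertex of the caterpillar: its spine index if it is a
spine vertex, and the spine index of its parent if it is a pendant. -/
noncomputable def SubCaterpillar.pos {G : SimpleGraph V} (C : SubCaterpillar G) (v : V) : ℕ :=
  sInf {i : ℕ | ∃ h : i < C.n,
    C.spine ⟨i, h⟩ = v ∨ (v ∉ Set.range C.spine ∧ G.Adj v (C.spine ⟨i, h⟩))}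

/-- `P` is a solution-tight packing of the spined caterpillar `C` with respect to `d`.
Packed (induced, connected) subgraphs are represented by their vertex sets. -/
def IsSTP (G : SimpleGraph V) (d : ℕ) (C : SubCaterpillar G) (P : Finset (Set V)) : Prop :=
  (∀ A ∈ P, A ⊆ C.verts ∧ d + 1 ≤ A.ncard ∧ (G.induce A).Connected) ∧
  ((↑P : Set (Set V)).Pairwise fun A B => Disjoint A B) ∧
  P.card = cocOptOn G C.verts d ∧
  (∀ A ∈ P, ∀ v ∈ C.verts, v ∉ Set.range C.spine → ∀ w ∈ A, G.Adj v w → v ∈ A) ∧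
  (∃ i : ℕ, i ≤ C.n ∧ ∀ j : Fin C.n, ((j : ℕ) < i ↔ ∃ A ∈ P, C.spine j ∈ A)) ∧
  (∀ A ∈ P, ∀ j : Fin C.n, C.spine j ∈ A →
    (∀ j' : Fin C.n, C.spine j' ∈ A → (j' : ℕ) ≤ (j : ℕ)) →
    IsCocSetOn G A d {C.spine j})

/-- A caterpillar forest on the vertex set `F` inside the ambient graph `G`,
with a fixed spine and spine order for each connected component. -/
structure SpinedCatForest (G : SimpleGraph V) (F : Set V) where
  numComps : ℕ
  comp : Fin numComps → SubCaterpillar G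
  sub : ∀ c, (comp c).verts ⊆ F
  cover : ∀ v ∈ F, ∃ c, v ∈ (comp c).verts
  disj : ∀ c c', c ≠ c' → Disjoint (comp c).verts (comp c').verts
  noCross : ∀ c c', c ≠ c' → ∀ v ∈ (comp c).verts, ∀ w ∈ (comp c').verts, ¬ G.Adj v w

/-- `P` is a solution-tight packing of the caterpillar forest `𝔉`: the union over the
connected components of solution-tight packings of the components. -/
def IsForestSTP (G : SimpleGraph V) (d : ℕ) {F : Set V} (𝔉 : SpinedCatForest G F)
    (P : Finset (Set V)) : Prop :=
  ∃ Q : Fin 𝔉.numComps → Finset (Set V),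
    (∀ c, IsSTP G d (𝔉.comp c) (Q c)) ∧
    (↑P : Set (Set V)) = ⋃ c, (↑(Q c) : Set (Set V))

/-- Attach `x` new pendant vertices to the vertex `v` of `H`. -/
def attachPendants (H : SimpleGraph W) (v : W) (x : ℕ) : SimpleGraph (W ⊕ Fin x) :=
  SimpleGraph.fromRel fun a b =>
    (∃ u u', a = Sum.inl u ∧ b = Sum.inl u' ∧ H.Adj u u') ∨
    (∃ i : Fin x, a = Sum.inl v ∧ b = Sum.inr i)

/-- The number of vertices of the connected component of `v` in the graph obtained
from `G[A]` by deleting `S` (this is `0` when `v ∈ S` or `v ∉ A`). -/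
noncomputable def compSizeOn (G : SimpleGraph V) (A S : Set V) (v : V) : ℕ :=
  {w : V | ∃ (hv : v ∈ A \ S) (hw : w ∈ A \ S),
    (G.induce (A \ S)).Reachable ⟨v, hv⟩ ⟨w, hw⟩}.ncard

/-- The essence of a spined caterpillar `C` relative to `d`. -/
noncomputable def SubCaterpillar.essence {G : SimpleGraph V} (C : SubCaterpillar G)
    (d : ℕ) : ℕ → ℕ := fun x =>
  let Cx : SimpleGraph (↥C.verts ⊕ Fin x) :=
    attachPendants (G.induce C.verts) ⟨C.spine ⟨0, C.npos⟩, C.spineMem ⟨0, C.npos⟩⟩ x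
  let vlast : ↥C.verts ⊕ Fin x :=
    Sum.inl ⟨C.spine ⟨C.n - 1, Nat.sub_lt C.npos Nat.one_pos⟩,
      C.spineMem ⟨C.n - 1, Nat.sub_lt C.npos Nat.one_pos⟩⟩
  if x ≤ d ∧ cocOptOn Cx Set.univ d = cocOptOn G C.verts d then
    sInf {b : ℕ | ∃ Y : Set (↥C.verts ⊕ Fin x),
      IsMinCocSetOn Cx Set.univ d Y ∧ b = compSizeOn Cx Set.univ Y vlast}
  else d + 1

/-- The set of vertices of `A` adjacent (in `G`) to some vertex of `X`. -/
def nbrIn (G : SimpleGraph V) (A X : Set V) : Set V :=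
  {v : V | v ∈ A ∧ ∃ m ∈ X, G.Adj v m}

/-- The chunk `X` imposes a (strictly positive) conflict on the subgraph of `G`
induced on the vertex set `A`. -/
def HasConflict (G : SimpleGraph V) (d : ℕ) (A X : Set V) : Prop :=
  cocOptOn G A d < (nbrIn G A X).ncard + cocOptOn G (A \ nbrIn G A X) d

/-- A chunk: a subset of the modulator `M` of size one or two. -/
def IsChunk (M X : Set V) : Prop := X ⊆ M ∧ 1 ≤ X.ncard ∧ X.ncard ≤ 2

/-- The `i`-th graph (0-based) of the `α`-merged packing of the ordered packing `H`. -/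
def mergedPiece {t : ℕ} (H : Fin t → Set V) (α i : ℕ) : Set V :=
  ⋃ (j : Fin t) (_ : i * α ≤ (j : ℕ) ∧ (j : ℕ) < i * α + α), H j

/-- `H` enumerates a solution-tight packing of `C` in left-to-right spine order. -/
def IsOrderedSTP (G : SimpleGraph V) (d : ℕ) (C : SubCaterpillar G) {t : ℕ}
    (H : Fin t → Set V) : Prop :=
  Function.Injective H ∧
  (∃ P : Finset (Set V), IsSTP G d C P ∧ (↑P : Set (Set V)) = Set.range H) ∧
  ∀ k k' : Fin t, k < k' → ∀ v ∈ H k, ∀ w ∈ H k', C.pos v < C.pos w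

/-- Composition of a list of functions: `compList [g₁, …, gₗ] = g₁ ∘ g₂ ∘ ⋯ ∘ gₗ`. -/
def compList (L : List (ℕ → ℕ)) : ℕ → ℕ := L.foldr (· ∘ ·) id

/-- `inc^d_i`: maps `i` to `i+1` and fixes all other inputs. -/
def incAt (i : ℕ) : ℕ → ℕ := fun x => if x = i then i + 1 else x

/-- `dec^d_i`: maps `i` to `i-1` and fixes all other inputs. -/
def decAt (i : ℕ) : ℕ → ℕ := fun x => if x = i then i - 1 else x

/-- `inc^d`: maps every `x` with `1 ≤ x ≤ d` to `x+1` and fixes all other inputs. -/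
def incUpTo (d : ℕ) : ℕ → ℕ := fun x => if 1 ≤ x ∧ x ≤ d then x + 1 else x

/-- `inc^d_{i,j}`: maps every `x` with `i ≤ x ≤ j` to `j` and fixes all other inputs. -/
def incIJ (i j : ℕ) : ℕ → ℕ := fun x => if i ≤ x ∧ x ≤ j then j else x

/-- `dec^d_{i,j}`: maps every `x` with `i ≤ x ≤ j` to `i` and fixes all other inputs. -/
def decIJ (i j : ℕ) : ℕ → ℕ := fun x => if i ≤ x ∧ x ≤ j then i else x

/-- The basic functions relative to `d`. -/
def IsBasicFun (d : ℕ) (f : ℕ → ℕ) : Prop :=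
  f = id ∨ (∃ i, 1 ≤ i ∧ i ≤ d ∧ f = decAt i) ∨ f = incUpTo d

/-- The advanced functions relative to `d`. -/
def IsAdvancedFun (d : ℕ) (f : ℕ → ℕ) : Prop :=
  (∃ i, 1 ≤ i ∧ i ≤ d ∧ f = incAt i) ∨
  (∃ i j, 1 ≤ i ∧ i < j ∧ j ≤ d + 1 ∧ f = incIJ i j) ∨
  (∃ i j, i < j ∧ j ≤ d ∧ f = decIJ i j)

/-- The number of fixed points of `f` on the domain `{0, …, d+1}`. -/
def fixCount (d : ℕ) (f : ℕ → ℕ) : ℕ :=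
  ((Finset.range (d + 2)).filter fun x => f x = x).card

/-- The disjoint union of `G₁` and `G₂` together with the edge `a b`. -/
def joinGraph {V₁ V₂ : Type} (G₁ : SimpleGraph V₁) (G₂ : SimpleGraph V₂)
    (a : V₁) (b : V₂) : SimpleGraph (V₁ ⊕ V₂) :=
  SimpleGraph.fromRel fun x y =>
    (∃ u w, x = Sum.inl u ∧ y = Sum.inl w ∧ G₁.Adj u w) ∨
    (∃ u w, x = Sum.inr u ∧ y = Sum.inr w ∧ G₂.Adj u w) ∨
    (x = Sum.inl a ∧ y = Sum.inr b)

/-- A connected induced subgraph meeting both `Y` and its complement has an edge between them. -/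
lemma exists_adj_of_connected_induce {G : SimpleGraph V} {X Y : Set V}
    (hX : (G.induce X).Connected) {a b : V} (haX : a ∈ X) (haY : a ∈ Y)
    (hbX : b ∈ X) (hbY : b ∉ Y) :
    ∃ x ∈ X, x ∈ Y ∧ ∃ y ∈ X, y ∉ Y ∧ G.Adj x y := by
  obtain ⟨p⟩ := hX.preconnected ⟨a, haX⟩ ⟨b, hbX⟩
  obtain ⟨e, -, h1, h2⟩ := p.exists_boundary_dart {x | x.1 ∈ Y} haY hbY
  exact ⟨e.fst.1, e.fst.2, h1, e.snd.1, e.snd.2, h2, e.adj⟩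

lemma connected_induce_singleton (G : SimpleGraph V) (v : V) :
    (G.induce ({v} : Set V)).Connected := by
  simp

/-- Adding an adjacent vertex keeps an induced subgraph connected. -/
lemma connected_induce_insert {G : SimpleGraph V} {X : Set V} (hX : (G.induce X).Connected)
    {x y : V} (hx : x ∈ X) (hxy : G.Adj x y) : (G.induce (insert y X)).Connected := by
  rw [Set.insert_eq, Set.union_comm]
  exact connected_induce_union hX.preconnected (connected_induce_singleton G y).preconnected
    hx rfl hxy

/-- A connected induced subgraph contains connected induced subgraphs of every smaller
positive order. -/
lemma exists_connected_subset_ncard_eq [Finite V] {G : SimpleGraph V} {X : Set V}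
    (hX : (G.induce X).Connected) (k : ℕ) (hk : k + 1 ≤ X.ncard) :
    ∃ Y ⊆ X, Y.ncard = k + 1 ∧ (G.induce Y).Connected := by
  induction k with
  | zero =>
    obtain ⟨⟨v, hv⟩⟩ := hX.nonempty
    exact ⟨{v}, by simpa using hv, by simp, connected_induce_singleton G v⟩
  | succ k ih =>
    obtain ⟨Y, hYX, hYc, hY⟩ := ih (by omega)
    obtain ⟨⟨a, ha⟩⟩ := hY.nonempty
    obtain ⟨b, hbX, hbY⟩ : ∃ b ∈ X, b ∉ Y := by
      by_contra! h
      have := Set.ncard_le_ncard (show X ⊆ Y from h)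
      omega
    obtain ⟨x, -, hxY, y, hyX, hyY, hxy⟩ :=
      exists_adj_of_connected_induce hX (hYX ha) ha hbX hbY
    exact ⟨insert y Y, Set.insert_subset hyX hYX, by
      rw [Set.ncard_insert_of_notMem hyY, hYc], connected_induce_insert hY hxY hxy⟩

/-- A `d`-coc set is a set hitting every connected induced subgraph on more than `d` vertices. -/
lemma isCocSetOn_iff [Finite V] {G : SimpleGraph V} {A S : Set V} {d : ℕ} :
    IsCocSetOn G A d S ↔ ∀ X ⊆ A \ S, (G.induce X).Connected → X.ncard ≤ d := by
  constructor
  · intro h X hXA hX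
    obtain ⟨⟨a, ha⟩⟩ := hX.nonempty
    refine le_trans ?_ (h ((G.induce (A \ S)).connectedComponentMk ⟨a, hXA ha⟩))
    rw [← Set.ncard_image_of_injective _ Subtype.val_injective]
    refine Set.ncard_le_ncard fun b hb => ⟨⟨b, hXA hb⟩, ?_, rfl⟩
    rw [ConnectedComponent.mem_supp_iff, ConnectedComponent.eq]
    exact (hX.preconnected ⟨b, hb⟩ ⟨a, ha⟩).map (induceHomOfLE G hXA).toHom
  · intro h c
    rw [← Set.ncard_image_of_injective _ Subtype.val_injective]
    refine h _ (by rintro _ ⟨x, -, rfl⟩; exact x.2) ?_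
    have hc : ((G.induce (A \ S)).induce c.supp).Connected := c.maximal_connected_induce_supp.1
    let f : (G.induce (A \ S)).induce c.supp →g G.induce (Subtype.val '' c.supp) :=
      ⟨fun x => ⟨x.1.1, x.1, x.2, rfl⟩, fun h => h⟩
    refine hc.map f ?_
    rintro ⟨_, x, hx, rfl⟩
    exact ⟨⟨x, hx⟩, rfl⟩

/-- In an acyclic graph, a vertex outside a connected vertex set has at most one neighbour
in that set. -/
lemma adj_unique_of_isAcyclic {G : SimpleGraph V} (hG : G.IsAcyclic) {C : Set V}
    (hC : (G.induce C).Connected) {v u w : V} (hv : v ∉ C) (hu : u ∈ C) (hw : w ∈ C)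
    (huv : G.Adj u v) (hwv : G.Adj w v) : u = w := by
  by_contra hne
  obtain ⟨p, hp⟩ := hC.exists_isPath ⟨u, hu⟩ ⟨w, hw⟩
  have hq : (Walk.cons huv (Walk.cons hwv.symm Walk.nil)).IsPath := by
    simp [Walk.cons_isPath_iff, hne, huv.ne, hwv.ne.symm]
  have hp' : (p.map (Embedding.induce C).toHom).IsPath :=
    hp.map Subtype.val_injective
  have hsupp := congrArg (fun q : G.Path u w => v ∈ q.1.support)
    ((isAcyclic_iff_subsingleton_path.1 hG u w).elim ⟨_, hp'⟩ ⟨_, hq⟩)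
  have hmem : v ∈ (p.map (Embedding.induce C).toHom).support := hsupp.mpr (by simp)
  rw [Walk.support_map, List.mem_map] at hmem
  obtain ⟨x, -, hx⟩ := hmem
  exact hv (hx ▸ x.2)

/-- Among connected subsets of `D` with more than `d` vertices there is one which is joined to
no further vertex of `D`. -/
lemma exists_connected_closed [Finite V] {G : SimpleGraph V} {D X : Set V} {d : ℕ} (hXD : X ⊆ D)
    (hX : (G.induce X).Connected) (hXd : d < X.ncard) :
    ∃ C ⊆ D, (G.induce C).Connected ∧ d < C.ncard ∧
      ∀ x ∈ C, ∀ y ∈ D, G.Adj x y → y ∈ C := by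
  obtain ⟨C, ⟨hCD, hC, hCd⟩, hmax⟩ := (Set.toFinite
    {C : Set V | C ⊆ D ∧ (G.induce C).Connected ∧ d < C.ncard}).exists_maximal ⟨X, hXD, hX, hXd⟩
  refine ⟨C, hCD, hC, hCd, fun x hx y hy hxy => ?_⟩
  refine hmax ⟨Set.insert_subset hy hCD, connected_induce_insert hC hx hxy, ?_⟩
    (Set.subset_insert y C) (Set.mem_insert y C)
  exact hCd.trans_le (Set.ncard_le_ncard (Set.subset_insert y C))

/-- In an acyclic graph, a vertex set containing a large connected subset contains a large
connected subset `B` attached through a single vertex `v`, with no large connected subset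
avoiding `v`. -/
lemma exists_minimal_pendant_subtree [Finite V] {G : SimpleGraph V} (hG : G.IsAcyclic)
    {A X : Set V} {d : ℕ} (hXA : X ⊆ A) (hX : (G.induce X).Connected) (hXd : d < X.ncard) :
    ∃ B ⊆ A, ∃ v ∈ B, (G.induce B).Connected ∧ d < B.ncard ∧
      (∀ x ∈ B, x ≠ v → ∀ y ∈ A, G.Adj x y → y ∈ B) ∧
      ∀ C ⊆ B \ {v}, (G.induce C).Connected → C.ncard ≤ d := by
  obtain ⟨B, ⟨hBA, v, hv, hB, hBd, hout⟩, hmin⟩ := (Set.toFinite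
    {B : Set V | B ⊆ A ∧ ∃ v ∈ B, (G.induce B).Connected ∧ d < B.ncard ∧
      ∀ x ∈ B, x ≠ v → ∀ y ∈ A, G.Adj x y → y ∈ B}).exists_minimal (by
    obtain ⟨C, hCA, hC, hCd, hout⟩ := exists_connected_closed hXA hX hXd
    obtain ⟨⟨v, hv⟩⟩ := hC.nonempty
    exact ⟨C, hCA, v, hv, hC, hCd, fun x hx _ => hout x hx⟩)
  refine ⟨B, hBA, v, hv, hB, hBd, hout, fun C hCB hC => ?_⟩
  by_contra! hCd
  obtain ⟨C', hCB', hC', hCd', hout'⟩ := exists_connected_closed hCB hC hCd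
  have hvC : v ∉ C' := fun h => (hCB' h).2 rfl
  have hsub : C' ⊆ B := fun x hx => (hCB' hx).1
  have hclosed : ∀ x ∈ C', ¬ G.Adj x v → ∀ y ∈ A, G.Adj x y → y ∈ C' := fun x hx hxv y hy hxy =>
    hout' x hx y ⟨hout x (hsub hx) (hCB' hx).2 y hy hxy, fun h => hxv (h ▸ hxy)⟩ hxy
  obtain ⟨u, hu, huniq⟩ : ∃ u ∈ C', ∀ x ∈ C', x ≠ u → ¬ G.Adj x v := by
    by_cases h : ∃ u ∈ C', G.Adj u v
    · obtain ⟨u, hu, huv⟩ := h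
      exact ⟨u, hu, fun x hx hne hxv => hne (adj_unique_of_isAcyclic hG hC' hvC hx hu hxv huv)⟩
    · push Not at h
      obtain ⟨⟨u, hu⟩⟩ := hC'.nonempty
      exact ⟨u, hu, fun x hx _ => h x hx⟩
  exact hvC (hmin ⟨hsub.trans hBA, u, hu, hC', hCd',
    fun x hx hne => hclosed x hx (huniq x hx hne)⟩ hsub hv)

/-- Every vertex set of a finite acyclic graph has a `d`-coc set no larger than some packing of
disjoint connected sets of `d + 1` vertices. -/
lemma exists_cocSet_packing [Finite V] {G : SimpleGraph V} (hG : G.IsAcyclic) (d : ℕ)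
    (A : Set V) :
    ∃ (S : Set V) (P : Finset (Set V)), S ⊆ A ∧ IsCocSetOn G A d S ∧
      (∀ B ∈ P, B ⊆ A ∧ B.ncard = d + 1 ∧ (G.induce B).Connected) ∧
      ((↑P : Set (Set V)).Pairwise fun B C => Disjoint B C) ∧ S.ncard ≤ P.card := by
  classical
  induction hn : A.ncard using Nat.strong_induction_on generalizing A with
  | _ n ih =>
  subst hn
  by_cases h : ∃ X ⊆ A, (G.induce X).Connected ∧ d < X.ncard
  swap
  · push Not at h
    exact ⟨∅, ∅, by simp, isCocSetOn_iff.2 (by simpa using h), by simp, by simp, by simp⟩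
  obtain ⟨X, hXA, hX, hXd⟩ := h
  obtain ⟨B, hBA, v, hv, hB, hBd, hout, hsmall⟩ := exists_minimal_pendant_subtree hG hXA hX hXd
  obtain ⟨S, P, hSA, hS, hP, hPd, hcard⟩ := ih (A \ B).ncard
    (Set.ncard_lt_ncard ⟨Set.sdiff_subset, fun h => (h (hBA hv)).2 hv⟩) (A \ B) rfl
  obtain ⟨Y, hYB, hYc, hY⟩ := exists_connected_subset_ncard_eq hB d hBd
  have hdisj : ∀ C ∈ P, Disjoint Y C := fun C hC =>
    Set.disjoint_left.2 fun y hy hyC => ((hP C hC).1 hyC).2 (hYB hy)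
  have hYP : Y ∉ P := fun h => by
    have : Y = ∅ := by simpa using hdisj Y h
    simp [this] at hYc
  refine ⟨insert v S, insert Y P, Set.insert_subset (hBA hv) (hSA.trans Set.sdiff_subset),
    ?_, ?_, ?_, ?_⟩
  · rw [isCocSetOn_iff] at hS ⊢
    intro Z hZ hZc
    by_cases h1 : Z ⊆ B
    · exact hsmall Z (fun z hz => ⟨h1 hz, fun h => (hZ hz).2 (Or.inl h)⟩) hZc
    · obtain ⟨b, hbZ, hbB⟩ := Set.not_subset.1 h1
      refine hS Z (fun z hz => ⟨⟨(hZ hz).1, fun hzB => ?_⟩, fun h => (hZ hz).2 (Or.inr h)⟩) hZc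
      obtain ⟨x, hxZ, hxB, y, hyZ, hyB, hxy⟩ :=
        exists_adj_of_connected_induce hZc hz hzB hbZ hbB
      exact hyB (hout x hxB (fun h => (hZ hxZ).2 (Or.inl h)) y (hZ hyZ).1 hxy)
  · simp only [Finset.mem_insert, forall_eq_or_imp]
    exact ⟨⟨hYB.trans hBA, hYc, hY⟩, fun C hC => ⟨(hP C hC).1.trans Set.sdiff_subset, (hP C hC).2⟩⟩
  · rw [Finset.coe_insert]
    exact hPd.insert fun C hC _ => ⟨hdisj C hC, (hdisj C hC).symm⟩
  · rw [Finset.card_insert_of_notMem hYP]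
    exact (Set.ncard_insert_le v S).trans (by omega)

/-- The parts of a finite set in the members of a disjoint family have total size at most the
size of the set. -/
lemma sum_ncard_inter_le [Finite V] (S : Set V) (P : Finset (Set V))
    (hP : (↑P : Set (Set V)).Pairwise fun A B => Disjoint A B) :
    ∑ A ∈ P, (S ∩ A).ncard ≤ S.ncard := by
  classical
  induction P using Finset.induction_on generalizing S with
  | empty => simp
  | insert A P hA ih =>
    rw [Finset.sum_insert hA, ← Set.ncard_inter_add_ncard_sdiff_eq_ncard S A]
    refine Nat.add_le_add_left (le_trans (le_of_eq ?_)
      (ih (S \ A) (hP.mono (by simp)))) _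
    refine Finset.sum_congr rfl fun B hB => congrArg Set.ncard ?_
    have hAB : Disjoint A B := hP (by simp) (by simp [hB]) (fun h => hA (h ▸ hB))
    ext x
    have hx : x ∈ A → x ∉ B := fun h1 h2 => Set.disjoint_left.1 hAB h1 h2
    simp only [Set.mem_inter_iff, Set.mem_sdiff]
    tauto

/-- Let `d ≥ 1`, `T` a finite tree, and `Pk` a maximum-size collection of
pairwise vertex-disjoint connected subgraphs of `T`, each on exactly `d+1` vertices.
Then the minimum size of a `d`-coc set of `T` equals `|Pk|`; in particular every minimum
`d`-coc set of `T` contains exactly one vertex of each graph of `Pk`. -/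
theorem stmt0 {V : Type} [Fintype V] (T : SimpleGraph V) (hT : T.IsTree)
    (d : ℕ) (hd : 1 ≤ d) (Pk : Finset (Set V))
    (hmem : ∀ A ∈ Pk, A.ncard = d + 1 ∧ (T.induce A).Connected)
    (hdisj : (↑Pk : Set (Set V)).Pairwise fun A B => Disjoint A B)
    (hmax : ∀ Qk : Finset (Set V),
      (∀ A ∈ Qk, A.ncard = d + 1 ∧ (T.induce A).Connected) →
      ((↑Qk : Set (Set V)).Pairwise fun A B => Disjoint A B) →
      Qk.card ≤ Pk.card) :
    cocOptOn T Set.univ d = Pk.card ∧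
      ∀ S : Set V, IsMinCocSetOn T Set.univ d S → ∀ A ∈ Pk, (S ∩ A).ncard = 1 := by
  have hhit : ∀ S : Set V, IsCocSetOn T Set.univ d S → ∀ A ∈ Pk, 1 ≤ (S ∩ A).ncard := by
    intro S hS A hA
    rw [isCocSetOn_iff] at hS
    by_contra! h
    have h0 : S ∩ A = ∅ := by
      rw [← Set.ncard_eq_zero]
      omega
    have := hS A (fun x hx => ⟨trivial, fun hxS => (h0 ▸ ⟨hxS, hx⟩ : x ∈ (∅ : Set V))⟩)
      (hmem A hA).2
    have := (hmem A hA).1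
    omega
  have hlower : ∀ S : Set V, IsCocSetOn T Set.univ d S → Pk.card ≤ S.ncard := fun S hS =>
    calc Pk.card = ∑ A ∈ Pk, 1 := by simp
      _ ≤ ∑ A ∈ Pk, (S ∩ A).ncard := Finset.sum_le_sum (hhit S hS)
      _ ≤ S.ncard := sum_ncard_inter_le S Pk hdisj
  obtain ⟨S₀, P, -, hS₀, hP, hPd, hcard⟩ := exists_cocSet_packing hT.isAcyclic d Set.univ
  have hPcard := hmax P (fun A hA => (hP A hA).2) hPd
  have hopt : cocOptOn T Set.univ d = Pk.card := by
    have hmemS : Pk.card ∈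
        {m : ℕ | ∃ S : Set V, S ⊆ Set.univ ∧ IsCocSetOn T Set.univ d S ∧ S.ncard = m} :=
      ⟨S₀, Set.subset_univ _, hS₀, le_antisymm (hcard.trans hPcard) (hlower S₀ hS₀)⟩
    refine le_antisymm (Nat.sInf_le hmemS) (le_csInf ⟨_, hmemS⟩ ?_)
    rintro m ⟨S, -, hS, rfl⟩
    exact hlower S hS
  refine ⟨hopt, fun S hS A hA => ?_⟩
  have hsum : ∑ A ∈ Pk, 1 = ∑ A ∈ Pk, (S ∩ A).ncard := by
    refine le_antisymm (Finset.sum_le_sum (hhit S hS.2.1)) ?_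
    have := sum_ncard_inter_le S Pk hdisj
    rw [hS.2.2, hopt] at this
    simpa using this
  exact ((Finset.sum_eq_sum_iff_of_le (hhit S hS.2.1)).1 hsum A hA).symm

end CocPaper
end

section
/- Let G be a finite simple graph, d ≥ 1 an integer, and X ⊆ V(G) a d-blocking set of G. If there exists a subset X' ⊆ X such that G − X' has two distinct connected components G₁ and G₂ with V(G₁) ∩ X ≠ ∅ and V(G₂) ∩ X ≠ ∅, then X is not a minimal d-blocking set of G. -/
namespace CocPaper

open SimpleGraph

variable {V : Type} {W : Type}

/-- If a vertex set `B` is closed under adjacency in `G - U`, and `U` agrees on `B` with a `d`-coc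
set `T`, then every component of `G - U` that meets `B` has at most `d` vertices. -/
lemma ncard_supp_le_of_inter_eq [Finite V] {G : SimpleGraph V} {d : ℕ} {T U B : Set V}
    (hT : IsCocSetOn G Set.univ d T) (hUT : U ∩ B = T ∩ B)
    (hB : ∀ v w, v ∈ B → v ∉ U → w ∉ U → G.Adj v w → w ∈ B)
    (v : ↥(Set.univ \ U)) (hv : (v : V) ∈ B) :
    ((G.induce (Set.univ \ U)).connectedComponentMk v).supp.ncard ≤ d := by
  have mem_iff : ∀ x ∈ B, (x ∈ U ↔ x ∈ T) := fun x hx => by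
    simpa [hx] using Set.ext_iff.mp hUT x
  have hvT : (v : V) ∈ Set.univ \ T := ⟨trivial, fun h => v.2.2 ((mem_iff _ hv).2 h)⟩
  have key : ∀ w : ↥(Set.univ \ U), (G.induce (Set.univ \ U)).Reachable v w →
      (w : V) ∈ B ∧ ∃ hw : (w : V) ∈ Set.univ \ T,
        (G.induce (Set.univ \ T)).Reachable ⟨v, hvT⟩ ⟨w, hw⟩ := by
    intro w hw
    rw [reachable_iff_reflTransGen] at hw
    induction hw with
    | refl => exact ⟨hv, hvT, Reachable.refl _⟩
    | @tail a b _ hab ih =>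
      obtain ⟨haB, haT, hr⟩ := ih
      have hbB := hB a b haB a.2.2 b.2.2 hab
      have hbT : (b : V) ∈ Set.univ \ T := ⟨trivial, fun h => b.2.2 ((mem_iff _ hbB).2 h)⟩
      have hadj : (G.induce (Set.univ \ T)).Adj ⟨a, haT⟩ ⟨b, hbT⟩ := hab
      exact ⟨hbB, hbT, hr.trans hadj.reachable⟩
  refine le_trans ?_ (hT ((G.induce (Set.univ \ T)).connectedComponentMk ⟨v, hvT⟩))
  rw [← Set.ncard_image_of_injective _ Subtype.val_injective,
    ← Set.ncard_image_of_injective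
      ((G.induce (Set.univ \ T)).connectedComponentMk ⟨v, hvT⟩).supp Subtype.val_injective]
  refine Set.ncard_le_ncard ?_ (Set.toFinite _)
  rintro _ ⟨w, hw, rfl⟩
  obtain ⟨-, hwT, hr⟩ := key w (ConnectedComponent.exact hw).symm
  exact ⟨⟨w, hwT⟩, ConnectedComponent.sound hr.symm, rfl⟩

/-- If `X` separates `A` from the other vertices, two `d`-coc sets containing `X` can be glued
along `A`. -/
lemma IsCocSetOn.glue [Finite V] {G : SimpleGraph V} {d : ℕ} {A X S T : Set V}
    (hA : ∀ v w, v ∈ A → G.Adj v w → w ∉ X → w ∈ A)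
    (hXS : X ⊆ S) (hS : IsCocSetOn G Set.univ d S) (hT : IsCocSetOn G Set.univ d T)
    (hXA : Disjoint X A) : IsCocSetOn G Set.univ d (S \ A ∪ T ∩ A) := by
  intro c
  induction c using ConnectedComponent.ind with
  | h v =>
    have not_mem : ∀ w, w ∉ S \ A ∪ T ∩ A → w ∉ X := fun w hw hwX =>
      hw (Or.inl ⟨hXS hwX, fun hwA => Set.disjoint_left.mp hXA hwX hwA⟩)
    by_cases hv : (v : V) ∈ A
    · refine ncard_supp_le_of_inter_eq hT (B := A) ?_ ?_ v hv
      · ext x; simp only [Set.mem_inter_iff, Set.mem_union, Set.mem_sdiff]; tauto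
      · exact fun x y hx _ hy hxy => hA x y hx hxy (not_mem y hy)
    · refine ncard_supp_le_of_inter_eq hS (B := Aᶜ) ?_ ?_ v hv
      · ext x; simp only [Set.mem_inter_iff, Set.mem_union, Set.mem_sdiff, Set.mem_compl_iff]; tauto
      · exact fun x y hx hxU _ hxy hy => hx (hA y x hy hxy.symm (not_mem x hxU))

lemma cocOptOn_le {G : SimpleGraph V} {A S : Set V} {d : ℕ} (hSA : S ⊆ A)
    (hS : IsCocSetOn G A d S) : cocOptOn G A d ≤ S.ncard :=
  Nat.sInf_le ⟨S, hSA, hS, rfl⟩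

lemma ncard_sdiff_union_inter [Finite V] (S T A : Set V) :
    (S \ A ∪ T ∩ A).ncard = (S \ A).ncard + (T ∩ A).ncard :=
  Set.ncard_union_eq (Set.disjoint_left.mpr fun _ h h' => h.2 h'.2)
    (Set.toFinite _) (Set.toFinite _)

/-- Let `G` be a finite simple graph, `d ≥ 1`, and `X` a `d`-blocking
set of `G`. If some `X' ⊆ X` is such that `G − X'` has two distinct connected components
both meeting `X`, then `X` is not a minimal `d`-blocking set of `G`. -/
theorem stmt1 {V : Type} [Fintype V] (G : SimpleGraph V) (d : ℕ) (hd : 1 ≤ d)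
    (X : Set V) (hX : IsBlockingSetOn G Set.univ d X)
    (h : ∃ X' : Set V, X' ⊆ X ∧
      ∃ c₁ c₂ : (G.induce X'ᶜ).ConnectedComponent, c₁ ≠ c₂ ∧
        (∃ v : ↥X'ᶜ, v ∈ c₁.supp ∧ (v : V) ∈ X) ∧
        (∃ v : ↥X'ᶜ, v ∈ c₂.supp ∧ (v : V) ∈ X)) :
    ¬ IsMinimalBlockingSetOn G Set.univ d X := by
  rintro ⟨-, hmin⟩
  obtain ⟨X', hX'X, c₁, c₂, hne, ⟨v₁, hv₁, hv₁X⟩, ⟨v₂, hv₂, hv₂X⟩⟩ := h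
  set A : Set V := Subtype.val '' c₁.supp with hAdef
  have hv₁A : (v₁ : V) ∈ A := ⟨v₁, hv₁, rfl⟩
  have hv₂A : (v₂ : V) ∉ A := by
    rintro ⟨w, hw, hwv⟩
    obtain rfl := Subtype.ext hwv
    exact hne (hw.symm.trans hv₂)
  have hXA : Disjoint X' A := by
    rw [Set.disjoint_left]
    rintro x hx ⟨w, -, rfl⟩
    exact w.2 hx
  have hA : ∀ v w, v ∈ A → G.Adj v w → w ∉ X' → w ∈ A := by
    rintro _ w ⟨v, hv, rfl⟩ hadj hw
    have hadj' : (G.induce X'ᶜ).Adj v ⟨w, hw⟩ := hadj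
    exact ⟨⟨w, hw⟩, c₁.mem_supp_of_adj_mem_supp hv hadj', rfl⟩
  have h₁ := hmin (X \ A) ⟨Set.sdiff_subset, fun hsub => (hsub hv₁X).2 hv₁A⟩
  have h₂ := hmin (X' ∪ X ∩ A) ⟨Set.union_subset hX'X Set.inter_subset_left, fun hsub =>
    (hsub hv₂X).elim v₂.2 fun hx => hv₂A hx.2⟩
  simp only [IsBlockingSetOn, not_forall, not_not] at h₁ h₂
  obtain ⟨S₁, ⟨-, hS₁, hcard₁⟩, hsub₁⟩ := h₁
  obtain ⟨S₂, ⟨-, hS₂, hcard₂⟩, hsub₂⟩ := h₂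
  have hXS₁ : X' ⊆ S₁ := fun x hx => hsub₁ ⟨hX'X hx, Set.disjoint_left.mp hXA hx⟩
  have hXS₂ : X' ⊆ S₂ := Set.subset_union_left.trans hsub₂
  have hU := hS₁.glue hA hXS₁ hS₂ hXA
  have hle := cocOptOn_le (Set.subset_univ _) hU
  have hle' := cocOptOn_le (Set.subset_univ _) (hS₂.glue hA hXS₂ hS₁ hXA)
  refine hX _ ⟨Set.subset_univ _, hU, ?_⟩ fun x hx => ?_
  · have e₁ := Set.ncard_inter_add_ncard_sdiff_eq_ncard S₁ A (Set.toFinite _)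
    have e₂ := Set.ncard_inter_add_ncard_sdiff_eq_ncard S₂ A (Set.toFinite _)
    rw [ncard_sdiff_union_inter] at hle hle' ⊢
    omega
  · by_cases hxA : x ∈ A
    · exact Or.inr ⟨hsub₂ (Or.inr ⟨hx, hxA⟩), hxA⟩
    · exact Or.inl ⟨hsub₁ ⟨hx, hxA⟩, hxA⟩

end CocPaper
end

section
/- Let G be a caterpillar forest, d a positive integer, and X ⊆ V(G) a minimal d-blocking set of G. Then |X| ≤ 2. -/
namespace CocPaper

open SimpleGraph

variable {V : Type} {W : Type}

/-- A linear layout of a caterpillar forest: `spine` lists the spine vertices, `pos` assigns to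
every vertex the position of the spine vertex it belongs to, and two vertices are adjacent exactly
when they are spine vertices at consecutive positions or a spine vertex and one of its pendants. -/
structure SpineLayout (G : SimpleGraph V) where
  spine : Set V
  pos : V → ℕ
  inj : ∀ p ∈ spine, ∀ q ∈ spine, pos p = pos q → p = q
  parent : ∀ x, ∃ p ∈ spine, pos p = pos x
  adj_iff : ∀ x y, G.Adj x y ↔
    (x ∈ spine ∧ y ∈ spine ∧ (pos x + 1 = pos y ∨ pos y + 1 = pos x)) ∨
    (pos x = pos y ∧ ((x ∈ spine ∧ y ∉ spine) ∨ (x ∉ spine ∧ y ∈ spine)))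

/-- Lexicographic order on pairs (cost, size of the last component). -/
def LexLE (u v : ℕ × ℕ) : Prop := u.1 < v.1 ∨ (u.1 = v.1 ∧ u.2 ≤ v.2)

/-- The state `v` is no better than `u` with its cost increased by one. -/
def IsHopeless (u v : ℕ × ℕ) : Prop := LexLE (u.1 + 1, u.2) v

section Greedy

open scoped Classical

/-- Greedy transition through a position with `a` forced and `w` unforced vertices, where `free`
says that there is a spine vertex and that it is not forced. -/
noncomputable def greedyStep (d : ℕ) (free : Prop) (a w : ℕ) (s : ℕ × ℕ) : ℕ × ℕ :=
  if free then if s.2 + w ≤ d then (s.1 + a, s.2 + w) else (s.1 + a + 1, 0) else (s.1 + a, 0)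

lemma greedyStep_mono {d a a' w w' : ℕ} {f f' : Prop} {u v : ℕ × ℕ} (hw : a + w = a' + w')
    (ha : a ≤ a') (hf : f' → f) (hff : f → ¬ f' → a < a') (huv : LexLE u v) :
    LexLE (greedyStep d f a w u) (greedyStep d f' a' w' v) := by
  unfold greedyStep LexLE at *
  split_ifs <;> simp_all <;> omega

lemma greedyStep_add_one (d : ℕ) (f : Prop) (a w : ℕ) (u : ℕ × ℕ) :
    greedyStep d f a w (u.1 + 1, u.2) =
      ((greedyStep d f a w u).1 + 1, (greedyStep d f a w u).2) := by
  unfold greedyStep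
  split_ifs <;> simp <;> omega

lemma isHopeless_greedyStep_of_two_le {d a w w' : ℕ} {f f' : Prop} {u v : ℕ × ℕ}
    (ha : 2 ≤ a) (huv : LexLE u v) :
    IsHopeless (greedyStep d f 0 w u) (greedyStep d f' a w' v) := by
  unfold IsHopeless greedyStep LexLE at *
  split_ifs <;> simp_all <;> omega

/-- After forcing one vertex, a worse state either leads to the same result as a better one
or is hopeless. -/
lemma greedyStep_one_eq_or_isHopeless {d w : ℕ} {f f' : Prop} {u v : ℕ × ℕ} (hf : f)
    (huv : LexLE u v) :
    greedyStep d f' 1 w v = greedyStep d f' 1 w u ∨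
      IsHopeless (greedyStep d f 0 (w + 1) u) (greedyStep d f' 1 w v) := by
  obtain ⟨c, r⟩ := u
  obtain ⟨c', r'⟩ := v
  unfold IsHopeless greedyStep LexLE at *
  split_ifs <;> simp_all <;> omega

namespace SpineLayout

variable {G : SimpleGraph V} (L : SpineLayout G)

/-- There is a spine vertex at position `i`, and it is not in `S`. -/
def Free (S : Finset V) (i : ℕ) : Prop := ∃ p ∈ L.spine, L.pos p = i ∧ p ∉ S

/-- The number of vertices of `S` left of position `i`. -/
noncomputable def cost (S : Finset V) (i : ℕ) : ℕ := (S.filter fun x => L.pos x < i).card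

lemma Free.anti {L : SpineLayout G} {X Y : Finset V} {i : ℕ} (h : X ⊆ Y) (hf : L.Free Y i) :
    L.Free X i := by
  obtain ⟨p, hp, hi, hY⟩ := hf
  exact ⟨p, hp, hi, fun hX => hY (h hX)⟩

lemma cost_congr {i : ℕ} {S T : Finset V} (h : ∀ x, L.pos x < i → (x ∈ S ↔ x ∈ T)) :
    L.cost S i = L.cost T i := by
  unfold cost
  congr 1
  ext x
  simp only [Finset.mem_filter]
  grind

lemma cost_eq_card {S : Finset V} {n : ℕ} (hn : ∀ x, L.pos x < n) : L.cost S n = S.card := by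
  simp [cost, hn]

variable [Fintype V]

/-- The vertices at position `i`. -/
noncomputable def block (i : ℕ) : Finset V := Finset.univ.filter fun x => L.pos x = i

/-- The state reached greedily at position `i` when the vertices of `X` have to be deleted. -/
noncomputable def greedy (d : ℕ) (X : Finset V) : ℕ → ℕ × ℕ
  | 0 => (0, 0)
  | i + 1 => greedyStep d (L.Free X i) (L.block i ∩ X).card (L.block i \ X).card (greedy d X i)

/-- The vertices left of position `i` in the component that reaches position `i - 1` after
deleting `S`. -/
noncomputable def tail (S : Finset V) : ℕ → Finset V
  | 0 => ∅
  | i + 1 => if L.Free S i then tail S i ∪ (L.block i \ S) else ∅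

@[simp] lemma mem_block {i : ℕ} {x : V} : x ∈ L.block i ↔ L.pos x = i := by simp [block]

lemma cost_succ (S : Finset V) (i : ℕ) :
    L.cost S (i + 1) = L.cost S i + (L.block i ∩ S).card := by
  unfold cost
  rw [← Finset.card_union_of_disjoint]
  · congr 1
    ext x
    simp
    grind
  · rw [Finset.disjoint_left]
    intro x hx
    simp at hx ⊢
    omega

lemma mem_tail {S : Finset V} {i : ℕ} {x : V} (hx : x ∈ L.tail S i) : L.pos x < i ∧ x ∉ S := by
  induction i with
  | zero => simp [tail] at hx
  | succ i ih =>
    unfold tail at hx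
    split_ifs at hx
    · simp at hx
      grind
    · simp at hx

lemma card_tail_succ (S : Finset V) (i : ℕ) (h : L.Free S i) :
    (L.tail S (i + 1)).card = (L.tail S i).card + (L.block i \ S).card := by
  rw [tail, if_pos h, Finset.card_union_of_disjoint]
  rw [Finset.disjoint_left]
  intro x hx
  have := (L.mem_tail hx).1
  simp
  omega

lemma card_inter_add_card_sdiff_block (X : Finset V) (i : ℕ) :
    (L.block i ∩ X).card + (L.block i \ X).card = (L.block i).card :=
  Finset.card_inter_add_card_sdiff _ _

lemma card_inter_block_lt {X Y : Finset V} {i : ℕ} (h : X ⊆ Y) (hX : L.Free X i)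
    (hY : ¬ L.Free Y i) : (L.block i ∩ X).card < (L.block i ∩ Y).card := by
  obtain ⟨p, hp, hi, hpX⟩ := hX
  apply Finset.card_lt_card
  refine ⟨Finset.inter_subset_inter_left h, fun hs => hpX ?_⟩
  have : p ∈ Y := by
    by_contra hpY
    exact hY ⟨p, hp, hi, hpY⟩
  exact (Finset.mem_inter.1 (hs (Finset.mem_inter.2 ⟨L.mem_block.2 hi, this⟩))).2

lemma greedyStep_mono_of_subset {X Y : Finset V} {i d : ℕ} {u v : ℕ × ℕ} (h : X ⊆ Y)
    (huv : LexLE u v) :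
    LexLE (greedyStep d (L.Free X i) (L.block i ∩ X).card (L.block i \ X).card u)
      (greedyStep d (L.Free Y i) (L.block i ∩ Y).card (L.block i \ Y).card v) := by
  apply greedyStep_mono _ (Finset.card_le_card (Finset.inter_subset_inter_left h))
    (Free.anti h) (L.card_inter_block_lt h) huv
  rw [card_inter_add_card_sdiff_block, card_inter_add_card_sdiff_block]

lemma greedy_mono {X Y : Finset V} (d : ℕ) (h : X ⊆ Y) (i : ℕ) :
    LexLE (L.greedy d X i) (L.greedy d Y i) := by
  induction i with
  | zero => simp [greedy, LexLE]
  | succ i ih => exact L.greedyStep_mono_of_subset h ih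

lemma isHopeless_greedy_add {d i : ℕ} {X : Finset V}
    (h : IsHopeless (L.greedy d ∅ i) (L.greedy d X i)) (k : ℕ) :
    IsHopeless (L.greedy d ∅ (i + k)) (L.greedy d X (i + k)) := by
  induction k with
  | zero => exact h
  | succ k ih =>
    have := L.greedyStep_mono_of_subset (i := i + k) (d := d) (Finset.empty_subset X) ih
    rw [greedyStep_add_one] at this
    exact this

lemma greedy_congr {d i : ℕ} {X Y : Finset V} (h : ∀ x, L.pos x < i → (x ∈ X ↔ x ∈ Y)) :
    L.greedy d X i = L.greedy d Y i := by
  induction i with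
  | zero => rfl
  | succ i ih =>
    have h1 : L.block i ∩ X = L.block i ∩ Y := by
      ext x
      simp only [Finset.mem_inter, mem_block]
      grind
    have h2 : L.block i \ X = L.block i \ Y := by
      ext x
      simp only [Finset.mem_sdiff, mem_block]
      grind
    have h3 : L.Free X i = L.Free Y i := by
      unfold Free
      grind
    rw [greedy, greedy, ih (fun x hx => h x (by omega)), h1, h2, h3]

/-- Unless two forced vertices are already hopeless, the greedy state is determined by a single
forced vertex. -/
lemma exists_greedy_eq {d : ℕ} {X : Finset V} {n : ℕ}
    (hX : ∀ Y ⊆ X, Y.card ≤ 2 → ∀ i ≤ n, ¬ IsHopeless (L.greedy d ∅ i) (L.greedy d Y i)) :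
    ∀ i ≤ n, ∃ Y ⊆ X, Y.card ≤ 1 ∧ (∀ y ∈ Y, L.pos y < i) ∧
      L.greedy d X i = L.greedy d Y i := by
  intro i
  induction i with
  | zero => exact fun _ => ⟨∅, by simp, by simp, by simp, rfl⟩
  | succ i ih =>
    intro hi
    obtain ⟨Y, hYX, hY1, hYi, hY⟩ := ih (by omega)
    rcases Nat.lt_or_ge (L.block i ∩ X).card 2 with hlt | hge
    · obtain h0 | ⟨a, ha⟩ : L.block i ∩ X = ∅ ∨ ∃ a, L.block i ∩ X = {a} := by
        rcases Nat.lt_or_ge (L.block i ∩ X).card 1 with h | h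
        · left
          rw [← Finset.card_eq_zero]
          omega
        · right
          rw [← Finset.card_eq_one]
          omega
      · refine ⟨Y, hYX, hY1, fun y hy => (hYi y hy).trans (Nat.lt_succ_self i), ?_⟩
        have hX0 : ∀ x, L.pos x = i → x ∉ X := fun x hx hxX => by
          have : x ∈ L.block i ∩ X := by simp [hx, hxX]
          simp [h0] at this
        have hY0 : ∀ x, L.pos x = i → x ∉ Y := fun x hx hxY => hX0 x hx (hYX hxY)
        have h1 : L.block i ∩ X = L.block i ∩ Y := by
          ext x
          simp only [Finset.mem_inter, mem_block]
          grind
        have h2 : L.block i \ X = L.block i \ Y := by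
          ext x
          simp only [Finset.mem_sdiff, mem_block]
          grind
        have h3 : L.Free X i = L.Free Y i := by
          unfold Free
          grind
        rw [greedy, greedy, hY, h1, h2, h3]
      · have haX : a ∈ L.block i ∩ X := by simp [ha]
        simp only [Finset.mem_inter, mem_block] at haX
        have hXa : ∀ x, L.pos x = i → (x ∈ X ↔ x = a) := fun x hx => by
          have : x ∈ L.block i ∩ X ↔ x = a := by simp [ha]
          simpa [hx] using this
        have key : ∀ Z : Finset V, (∀ x, L.pos x = i → (x ∈ Z ↔ x = a)) →
            L.greedy d Z (i + 1) = greedyStep d (L.Free {a} i) 1 (L.block i \ {a}).card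
              (L.greedy d Z i) := by
          intro Z hZ
          have h1 : L.block i ∩ Z = {a} := by
            ext x
            simp only [Finset.mem_inter, mem_block, Finset.mem_singleton]
            grind
          have h2 : L.block i \ Z = L.block i \ {a} := by
            ext x
            simp only [Finset.mem_sdiff, mem_block, Finset.mem_singleton]
            grind
          have h3 : L.Free Z i = L.Free {a} i := by
            unfold Free
            simp only [Finset.mem_singleton]
            grind
          rw [greedy, h1, h2, h3, Finset.card_singleton]
        have hfree : L.Free ∅ i := by
          obtain ⟨p, hp, hpa⟩ := L.parent a
          exact ⟨p, hp, hpa.trans haX.1, by simp⟩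
        have hcard : (L.block i \ ∅).card = (L.block i \ {a}).card + 1 := by
          rw [Finset.sdiff_empty, ← L.card_inter_add_card_sdiff_block {a} i]
          have : L.block i ∩ {a} = {a} := by simp [haX.1]
          rw [this, Finset.card_singleton, add_comm]
        have hempty : L.greedy d ∅ (i + 1) =
            greedyStep d (L.Free ∅ i) 0 ((L.block i \ {a}).card + 1) (L.greedy d ∅ i) := by
          rw [greedy, hcard]
          simp
        have hai : L.greedy d {a} i = L.greedy d ∅ i := by
          apply L.greedy_congr
          intro x hx
          simp only [Finset.mem_singleton, Finset.notMem_empty, iff_false]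
          rintro rfl
          omega
        have hZi : L.greedy d (insert a Y) i = L.greedy d Y i := by
          apply L.greedy_congr
          intro x hx
          simp only [Finset.mem_insert, or_iff_right_iff_imp]
          rintro rfl
          omega
        rcases greedyStep_one_eq_or_isHopeless (d := d) (w := (L.block i \ {a}).card)
          (f' := L.Free {a} i) hfree (L.greedy_mono d (Finset.empty_subset Y) i) with h | h
        · refine ⟨{a}, by simpa using haX.2, by simp, by simp [haX.1], ?_⟩
          rw [key X hXa, key {a} (by simp), hY, h, hai]
        · exfalso
          refine hX (insert a Y) (Finset.insert_subset haX.2 hYX)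
            ((Finset.card_insert_le _ _).trans (by omega)) (i + 1) hi ?_
          rw [hempty, key (insert a Y), hZi]
          · exact h
          · intro x hx
            have : x ∉ Y := fun h => by
              have := hYi x h
              omega
            simp [this]
    · exfalso
      obtain ⟨Z, hZ, hZ2⟩ := Finset.exists_subset_card_eq hge
      refine hX Z (hZ.trans Finset.inter_subset_right) hZ2.le (i + 1) hi ?_
      have hZb : L.block i ∩ Z = Z :=
        Finset.inter_eq_right.2 (hZ.trans Finset.inter_subset_left)
      have := isHopeless_greedyStep_of_two_le (d := d) (w := (L.block i \ ∅).card)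
        (w' := (L.block i \ Z).card) (f := L.Free ∅ i) (f' := L.Free Z i) hZ2.ge
        (L.greedy_mono d (Finset.empty_subset Z) i)
      rw [greedy, greedy, hZb]
      simpa using this

lemma greedy_le {d : ℕ} {X S : Finset V} (h : X ⊆ S) (hS : ∀ i, (L.tail S i).card ≤ d) (i : ℕ) :
    LexLE (L.greedy d X i) (L.cost S i, (L.tail S i).card) := by
  induction i with
  | zero => simp [greedy, LexLE, tail, cost]
  | succ i ih =>
    have h1 := L.greedyStep_mono_of_subset (i := i) (d := d) h ih
    have h2 : greedyStep d (L.Free S i) (L.block i ∩ S).card (L.block i \ S).card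
        (L.cost S i, (L.tail S i).card) = (L.cost S (i + 1), (L.tail S (i + 1)).card) := by
      by_cases hf : L.Free S i
      · have h3 := hS (i + 1)
        rw [L.card_tail_succ S i hf] at h3
        rw [greedyStep, if_pos hf, if_pos h3, cost_succ, L.card_tail_succ S i hf]
      · rw [greedyStep, if_neg hf, cost_succ]
        simp [tail, hf]
    rw [← h2]
    exact h1

lemma tail_congr {i : ℕ} {S T : Finset V} (h : ∀ x, L.pos x < i → (x ∈ S ↔ x ∈ T)) :
    L.tail S i = L.tail T i := by
  induction i with
  | zero => rfl
  | succ i ih =>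
    have h2 : L.block i \ S = L.block i \ T := by
      ext x
      simp only [Finset.mem_sdiff, mem_block]
      grind
    have h3 : L.Free S i = L.Free T i := by
      unfold Free
      grind
    simp only [tail, ih (fun x hx => h x (by omega)), h2, h3]

/-- Deleting a set `B` of vertices at position `n` in addition to a set `S` of vertices further
left. -/
lemma cost_tail_union {n : ℕ} {S B : Finset V} (hS : ∀ x ∈ S, L.pos x < n) (hB : B ⊆ L.block n) :
    (∀ i ≤ n, L.tail (S ∪ B) i = L.tail S i) ∧
      L.cost (S ∪ B) (n + 1) = L.cost S n + B.card ∧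
      (L.tail (S ∪ B) (n + 1)).card =
        if L.Free B n then (L.tail S n).card + (L.block n \ B).card else 0 := by
  have hBn : ∀ x ∈ B, L.pos x = n := fun x hx => L.mem_block.1 (hB hx)
  have hlt : ∀ x, L.pos x < n → (x ∈ S ∪ B ↔ x ∈ S) := fun x hx => by
    have : x ∉ B := fun h => hx.ne (hBn x h)
    simp [this]
  have heq : ∀ x, L.pos x = n → (x ∈ S ∪ B ↔ x ∈ B) := fun x hx => by
    have : x ∉ S := fun h => (hS x h).ne hx
    simp [this]
  have h1 : L.block n ∩ (S ∪ B) = B := by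
    ext x
    simp only [Finset.mem_inter, mem_block]
    exact ⟨fun h => (heq x h.1).1 h.2, fun h => ⟨hBn x h, Finset.mem_union_right _ h⟩⟩
  have h2 : L.block n \ (S ∪ B) = L.block n \ B := by
    ext x
    simp only [Finset.mem_sdiff, mem_block]
    exact and_congr_right fun h => not_congr (heq x h)
  have h3 : L.Free (S ∪ B) n ↔ L.Free B n :=
    exists_congr fun x => and_congr_right fun _ => and_congr_right fun h => not_congr (heq x h)
  refine ⟨fun i hi => L.tail_congr fun x hx => hlt x (hx.trans_le hi), ?_, ?_⟩
  · rw [cost_succ, h1, L.cost_congr hlt]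
  · split_ifs with hf
    · rw [L.card_tail_succ _ _ (h3.2 hf), L.tail_congr hlt, h2]
    · rw [tail, if_neg (h3.not.2 hf), Finset.card_empty]

lemma exists_greedyStep_eq (d : ℕ) (X : Finset V) (n t : ℕ) (c : ℕ) :
    ∃ B ⊆ L.block n, L.block n ∩ X ⊆ B ∧
      (L.Free B n → t + (L.block n \ B).card ≤ d) ∧
      (c + B.card, if L.Free B n then t + (L.block n \ B).card else 0) =
        greedyStep d (L.Free X n) (L.block n ∩ X).card (L.block n \ X).card (c, t) := by
  have hfX : L.Free (L.block n ∩ X) n ↔ L.Free X n := by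
    unfold Free
    simp only [Finset.mem_inter, mem_block]
    grind
  have hsd : L.block n \ (L.block n ∩ X) = L.block n \ X := by simp
  by_cases hf : L.Free X n
  · by_cases hle : t + (L.block n \ X).card ≤ d
    · refine ⟨L.block n ∩ X, Finset.inter_subset_left, subset_rfl, fun _ => by rwa [hsd], ?_⟩
      rw [if_pos (hfX.2 hf), greedyStep, if_pos hf, if_pos hle, hsd]
    · obtain ⟨p, hp, hpn, hpX⟩ := hf
      have hnf : ¬ L.Free (insert p (L.block n ∩ X)) n := by
        rintro ⟨q, hq, hqn, hqX⟩
        exact hqX (by simp [L.inj q hq p hp (hqn.trans hpn.symm)])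
      refine ⟨insert p (L.block n ∩ X),
        Finset.insert_subset (by simp [hpn]) Finset.inter_subset_left,
        Finset.subset_insert _ _, fun h => absurd h hnf, ?_⟩
      rw [if_neg hnf, greedyStep, if_pos ⟨p, hp, hpn, hpX⟩, if_neg hle,
        Finset.card_insert_of_notMem (by simp [hpX]), add_assoc]
  · refine ⟨L.block n ∩ X, Finset.inter_subset_left, subset_rfl,
      fun h => absurd (hfX.1 h) hf, ?_⟩
    rw [if_neg (hfX.not.2 hf), greedyStep, if_neg hf]

lemma exists_eq_greedy (d : ℕ) (X : Finset V) (n : ℕ) :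
    ∃ S : Finset V, (∀ x ∈ S, L.pos x < n) ∧ (∀ x ∈ X, L.pos x < n → x ∈ S) ∧
      (∀ i ≤ n, (L.tail S i).card ≤ d) ∧
      (L.cost S n, (L.tail S n).card) = L.greedy d X n := by
  induction n with
  | zero => exact ⟨∅, by simp, by simp, by simp [tail], by simp [cost, tail, greedy]⟩
  | succ n ih =>
    obtain ⟨S, hSn, hXS, hSd, hS⟩ := ih
    obtain ⟨B, hB, hXB, hd, hg⟩ := L.exists_greedyStep_eq d X n (L.tail S n).card (L.cost S n)
    obtain ⟨h1, h2, h3⟩ := L.cost_tail_union hSn hB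
    refine ⟨S ∪ B, ?_, ?_, ?_, ?_⟩
    · intro x hx
      rcases Finset.mem_union.1 hx with hx | hx
      · exact (hSn x hx).trans (Nat.lt_succ_self n)
      · rw [L.mem_block.1 (hB hx)]
        exact Nat.lt_succ_self n
    · intro x hx hxn
      rcases Nat.lt_succ_iff_lt_or_eq.1 hxn with h | h
      · exact Finset.mem_union_left _ (hXS x hx h)
      · exact Finset.mem_union_right _ (hXB (by simp [h, hx]))
    · intro i hi
      rcases Nat.le_succ_iff.1 hi with hi | rfl
      · rw [h1 i hi]
        exact hSd i hi
      · rw [h3]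
        split_ifs with hf
        · exact hd hf
        · exact Nat.zero_le _
    · rw [h2, h3, hg, hS, greedy]

end SpineLayout

end Greedy

section Components

open scoped Classical

namespace SpineLayout

variable {G : SimpleGraph V} [Fintype V] (L : SpineLayout G)

lemma reachable_of_mem_tail {S : Finset V} (i : ℕ) :
    ∀ p : ↥(Set.univ \ (S : Set V)), p.1 ∈ L.spine → L.pos p.1 = i →
      ∀ x : ↥(Set.univ \ (S : Set V)), x.1 ∈ L.tail S (i + 1) →
        (G.induce (Set.univ \ (S : Set V))).Reachable p x := by
  induction i with
  | zero =>
    intro p hp hpi x hx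
    have hx0 := (L.mem_tail hx).1
    by_cases hxs : x.1 ∈ L.spine
    · rw [Subtype.ext (L.inj p.1 hp x.1 hxs (by omega))]
    · refine SimpleGraph.Adj.reachable ?_
      rw [SimpleGraph.induce_adj, L.adj_iff]
      exact Or.inr ⟨by omega, Or.inl ⟨hp, hxs⟩⟩
  | succ i ih =>
    intro p hp hpi x hx
    have hxi := (L.mem_tail hx).1
    rcases Nat.lt_succ_iff_lt_or_eq.1 hxi with h | h
    · have hx' : x.1 ∈ L.tail S (i + 1) := by
        rw [tail] at hx
        split_ifs at hx
        · rcases Finset.mem_union.1 hx with hx | hx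
          · exact hx
          · simp at hx
            omega
        · simp at hx
      have hf : L.Free S i := by
        by_contra hf
        rw [tail, if_neg hf] at hx'
        simp at hx'
      obtain ⟨q, hq, hqi, hqS⟩ := hf
      refine SimpleGraph.Reachable.trans (SimpleGraph.Adj.reachable ?_)
        (ih ⟨q, trivial, by simpa using hqS⟩ hq hqi x hx')
      rw [SimpleGraph.induce_adj, L.adj_iff]
      exact Or.inl ⟨hp, hq, Or.inr (by simp [hqi, hpi])⟩
    · by_cases hxs : x.1 ∈ L.spine
      · rw [Subtype.ext (L.inj p.1 hp x.1 hxs (by omega))]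
      · refine SimpleGraph.Adj.reachable ?_
        rw [SimpleGraph.induce_adj, L.adj_iff]
        exact Or.inr ⟨by omega, Or.inl ⟨hp, hxs⟩⟩

/-- A set of remaining vertices reaching position `i` can only be left through the spine vertex
at position `i`. -/
lemma mem_tail_or_of_adj {S : Finset V} {i : ℕ} {x y : V} (hx : x ∈ L.tail S i)
    (hxy : G.Adj x y) (hy : y ∉ S) : y ∈ L.tail S i ∨ (y ∈ L.spine ∧ L.pos y = i) := by
  induction i generalizing x y with
  | zero => simp [tail] at hx
  | succ i ih =>
    have hf : L.Free S i := by
      by_contra hf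
      rw [tail, if_neg hf] at hx
      simp at hx
    simp only [tail, if_pos hf, Finset.mem_union, Finset.mem_sdiff, mem_block] at hx ⊢
    rcases hx with hx | ⟨hxi, hxS⟩
    · rcases ih hx hxy hy with h | h
      · exact Or.inl (Or.inl h)
      · exact Or.inl (Or.inr ⟨h.2, hy⟩)
    · rcases (L.adj_iff x y).1 hxy with ⟨hxs, hys, h | h⟩ | ⟨h, -⟩
      · exact Or.inr ⟨hys, by omega⟩
      · refine Or.inl (Or.inl ?_)
        subst hxi
        rw [← h, tail, if_pos ⟨y, hys, rfl, hy⟩]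
        simp [hy]
      · exact Or.inl (Or.inr ⟨by omega, hy⟩)

lemma isCocSetOn_iff {d : ℕ} (hd : 1 ≤ d) (S : Finset V) :
    IsCocSetOn G Set.univ d S ↔ ∀ i, (L.tail S i).card ≤ d := by
  constructor
  · intro h i
    cases i with
    | zero => simp [tail]
    | succ i =>
      by_cases hf : L.Free S i
      · obtain ⟨p, hp, hpi, hpS⟩ := hf
        let p' : ↥(Set.univ \ (S : Set V)) := ⟨p, trivial, by simpa using hpS⟩
        refine le_trans ?_ (h ((G.induce _).connectedComponentMk p'))
        rw [← Set.ncard_coe_finset, ← Set.ncard_image_of_injective _ Subtype.val_injective]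
        refine Set.ncard_le_ncard (fun x hx => ?_) (Set.toFinite _)
        have hxS := (L.mem_tail hx).2
        refine ⟨⟨x, trivial, by simpa using hxS⟩, ?_, rfl⟩
        rw [SimpleGraph.ConnectedComponent.mem_supp_iff, SimpleGraph.ConnectedComponent.eq]
        exact (L.reachable_of_mem_tail i p' hp hpi _ hx).symm
      · simp [tail, hf]
  · intro h c
    by_cases hc : ∃ p ∈ c.supp, p.1 ∈ L.spine
    · obtain ⟨p, ⟨hpc, hps⟩, hmax⟩ := Set.exists_max_image
        {p : ↥(Set.univ \ (S : Set V)) | p ∈ c.supp ∧ p.1 ∈ L.spine} (fun p => L.pos p.1)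
        (Set.toFinite _) hc
      refine le_trans ?_ (h (L.pos p.1 + 1))
      rw [← Set.ncard_coe_finset, ← Set.ncard_image_of_injective _ Subtype.val_injective]
      refine Set.ncard_le_ncard ?_ (Set.toFinite _)
      rintro _ ⟨x, hx, rfl⟩
      have hpx : (G.induce (Set.univ \ (S : Set V))).Reachable p x := by
        rw [SimpleGraph.ConnectedComponent.mem_supp_iff] at hpc hx
        exact SimpleGraph.ConnectedComponent.exact (hpc.trans hx.symm)
      have hpS : p.1 ∉ S := fun h => p.2.2 (Finset.mem_coe.2 h)
      rw [SimpleGraph.reachable_iff_reflTransGen] at hpx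
      have key : x ∈ c.supp ∧ x.1 ∈ L.tail S (L.pos p.1 + 1) := by
        clear hx
        induction hpx with
        | refl =>
          refine ⟨hpc, ?_⟩
          rw [tail, if_pos ⟨p.1, hps, rfl, hpS⟩]
          simp [hpS]
        | @tail y z _ hyz ih =>
          have hzc : z ∈ c.supp := by
            have := ih.1
            rw [SimpleGraph.ConnectedComponent.mem_supp_iff] at this ⊢
            rw [← this]
            exact SimpleGraph.ConnectedComponent.sound hyz.reachable.symm
          refine ⟨hzc, ?_⟩
          rcases L.mem_tail_or_of_adj ih.2 hyz (fun h => z.2.2 (Finset.mem_coe.2 h)) with hz | ⟨hzs, hz⟩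
          · exact hz
          · have : L.pos z.1 ≤ L.pos p.1 := hmax z ⟨hzc, hzs⟩
            have hz' : L.pos z.1 = L.pos p.1 + 1 := hz
            omega
      exact key.2
    · push Not at hc
      refine le_trans ?_ hd
      rw [Set.ncard_le_one (Set.toFinite _)]
      intro x hx y hy
      have hxy : (G.induce (Set.univ \ (S : Set V))).Reachable x y := by
        rw [SimpleGraph.ConnectedComponent.mem_supp_iff] at hx hy
        exact SimpleGraph.ConnectedComponent.exact (hx.trans hy.symm)
      rw [SimpleGraph.reachable_iff_reflTransGen, Relation.ReflTransGen.cases_head_iff] at hxy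
      rcases hxy with h | ⟨z, hxz, -⟩
      · exact h
      · have hz : z ∈ c.supp := by
          rw [SimpleGraph.ConnectedComponent.mem_supp_iff] at hx ⊢
          rw [← hx]
          exact SimpleGraph.ConnectedComponent.sound hxz.reachable.symm
        have h1 := hc x hx
        have h2 := hc z hz
        rcases (L.adj_iff x.1 z.1).1 hxz with h | h
        · exact absurd h.1 h1
        · tauto

lemma exists_isCocSetOn_card_eq_greedy {d : ℕ} (hd : 1 ≤ d) (X : Finset V) {n : ℕ}
    (hn : ∀ x, L.pos x < n) :
    ∃ S : Finset V, X ⊆ S ∧ IsCocSetOn G Set.univ d S ∧ S.card = (L.greedy d X n).1 := by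
  obtain ⟨S, -, hXS, hSd, hS⟩ := L.exists_eq_greedy d X n
  refine ⟨S, fun x hx => hXS x hx (hn x), ?_, ?_⟩
  · rw [L.isCocSetOn_iff hd]
    intro i
    rcases Nat.lt_or_ge n i with hi | hi
    · obtain ⟨j, rfl⟩ := Nat.exists_eq_add_of_lt hi
      have : ¬ L.Free S (n + j) := by
        rintro ⟨p, -, hp, -⟩
        have := hn p
        omega
      simp [tail, this]
    · exact hSd i hi
  · rw [← hS, L.cost_eq_card hn]

lemma greedy_fst_le_card {d : ℕ} (hd : 1 ≤ d) {X S : Finset V} {n : ℕ}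
    (hn : ∀ x, L.pos x < n) (hXS : X ⊆ S) (hS : IsCocSetOn G Set.univ d S) :
    (L.greedy d X n).1 ≤ S.card := by
  have := L.greedy_le hXS ((L.isCocSetOn_iff hd S).1 hS) n
  rw [L.cost_eq_card hn] at this
  unfold LexLE at this
  simp only at this
  omega

theorem ncard_le_two_of_isMinimalBlockingSetOn (L : SpineLayout G) {d : ℕ} (hd : 1 ≤ d) {X : Set V}
    (hX : IsMinimalBlockingSetOn G Set.univ d X) : X.ncard ≤ 2 := by
  by_contra! h2
  obtain ⟨hblock, hmin⟩ := hX
  lift X to Finset V using Set.toFinite X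
  rw [Set.ncard_coe_finset] at h2
  let n := Finset.univ.sup L.pos + 1
  have hn : ∀ x, L.pos x < n := fun x =>
    Nat.lt_succ_of_le (Finset.le_sup (f := L.pos) (Finset.mem_univ x))
  have hsmall : ∀ Y ⊆ X, Y.card ≤ 2 → (L.greedy d Y n).1 ≤ cocOptOn G Set.univ d := by
    intro Y hYX hY
    have hssub : (Y : Set V) ⊂ X := by
      rw [Finset.coe_ssubset]
      exact Finset.ssubset_iff_subset_ne.2 ⟨hYX, by rintro rfl; omega⟩
    have := hmin Y hssub
    unfold IsBlockingSetOn at this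
    push Not at this
    obtain ⟨S, ⟨-, hS, hopt⟩, hYS⟩ := this
    lift S to Finset V using Set.toFinite S
    rw [← hopt, Set.ncard_coe_finset]
    exact L.greedy_fst_le_card hd hn (Finset.coe_subset.1 hYS) hS
  have hopt : ∀ S : Finset V, IsCocSetOn G Set.univ d S → cocOptOn G Set.univ d ≤ S.card :=
    fun S hS => Nat.sInf_le ⟨S, Set.subset_univ _, hS, Set.ncard_coe_finset S⟩
  have hempty : cocOptOn G Set.univ d ≤ (L.greedy d ∅ n).1 := by
    obtain ⟨S, -, hS, hcard⟩ := L.exists_isCocSetOn_card_eq_greedy hd ∅ hn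
    rw [← hcard]
    exact hopt S hS
  obtain ⟨Y, hYX, hY1, -, hY⟩ := L.exists_greedy_eq (d := d) (X := X) (n := n)
    (fun Y hYX hY i hi hbad => by
      have h := L.isHopeless_greedy_add hbad (n - i)
      rw [Nat.add_sub_cancel' hi] at h
      have := hsmall Y hYX hY
      unfold IsHopeless LexLE at h
      simp only at h
      omega) n le_rfl
  obtain ⟨S, hXS, hS, hcard⟩ := L.exists_isCocSetOn_card_eq_greedy hd X hn
  refine hblock S ⟨Set.subset_univ _, hS, ?_⟩ (Finset.coe_subset.2 hXS)
  refine le_antisymm ?_ ?_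
  · rw [Set.ncard_coe_finset, hcard, hY]
    exact hsmall Y hYX (by omega)
  · rw [Set.ncard_coe_finset]
    exact hopt S hS

end SpineLayout

end Components

/-- Either two adjacent vertices of degree one form the whole caterpillar, or the vertices of
degree other than one form a spine. -/
lemma IsCaterpillar.nonempty_spineLayout [Finite V] {G : SimpleGraph V} (hG : IsCaterpillar G) :
    Nonempty (SpineLayout G) := by
  classical
  obtain ⟨hT, n, ⟨e⟩⟩ := hG
  have hconn : G.Connected := hT.connected
  have huniq : ∀ v a b : V, (G.neighborSet v).ncard = 1 → G.Adj v a → G.Adj v b → a = b := by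
    intro v a b hv ha hb
    obtain ⟨c, hc⟩ := Set.ncard_eq_one.1 hv
    have ha' : a ∈ G.neighborSet v := ha
    have hb' : b ∈ G.neighborSet v := hb
    rw [hc] at ha' hb'
    exact ha'.trans hb'.symm
  by_cases hpair : ∃ v q, G.Adj v q ∧ (G.neighborSet v).ncard = 1 ∧ (G.neighborSet q).ncard = 1
  · obtain ⟨v, q, hvq, hv, hq⟩ := hpair
    have hall : ∀ x, x = v ∨ x = q := by
      intro x
      have := hconn.preconnected v x
      rw [SimpleGraph.reachable_iff_reflTransGen] at this
      induction this with
      | refl => exact Or.inl rfl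
      | tail _ hyz ih =>
        rcases ih with rfl | rfl
        · exact Or.inr (huniq _ _ _ hv hyz hvq)
        · exact Or.inl (huniq _ _ _ hq hyz hvq.symm)
    refine ⟨{ spine := {v}, pos := fun _ => 0, inj := ?_, parent := ?_, adj_iff := ?_ }⟩
    · rintro p rfl r rfl -
      rfl
    · exact fun x => ⟨v, rfl, rfl⟩
    · intro x y
      have hne := hvq.ne
      have hne' := hvq.ne'
      rcases hall x with rfl | rfl <;> rcases hall y with rfl | rfl <;>
        simp [hvq, hvq.symm, hne']
  · push Not at hpair
    have hpar : ∀ x, ∃ p : {v : V | (G.neighborSet v).ncard ≠ 1},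
        if (G.neighborSet x).ncard ≠ 1 then p.1 = x else G.Adj x p.1 := by
      intro x
      by_cases hx : (G.neighborSet x).ncard = 1
      · obtain ⟨q, hq⟩ := Set.ncard_eq_one.1 hx
        have hxq : G.Adj x q := by
          have : q ∈ G.neighborSet x := by simp [hq]
          exact this
        exact ⟨⟨q, hpair x q hxq hx⟩, by simpa [hx] using hxq⟩
      · exact ⟨⟨x, hx⟩, by simp [hx]⟩
    choose par hpar using hpar
    have hpar1 : ∀ x, (G.neighborSet x).ncard = 1 → G.Adj x (par x).1 := fun x hx => by
      simpa [hx] using hpar x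
    have hpar2 : ∀ x (hx : (G.neighborSet x).ncard ≠ 1), par x = ⟨x, hx⟩ := fun x hx => by
      have := hpar x
      rw [if_pos hx] at this
      exact Subtype.ext this
    have hposinj : ∀ x y, (e (par x) : ℕ) = e (par y) → par x = par y := fun x y h =>
      e.injective (Fin.ext h)
    have hmem : ∀ v, v ∈ {v : V | (G.neighborSet v).ncard ≠ 1} ↔ (G.neighborSet v).ncard ≠ 1 :=
      fun _ => Iff.rfl
    refine ⟨{
      spine := {v : V | (G.neighborSet v).ncard ≠ 1}
      pos := fun x => e (par x)
      inj := ?_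
      parent := ?_
      adj_iff := ?_ }⟩
    · intro p hp q hq h
      have := hposinj p q h
      rw [hpar2 p hp, hpar2 q hq] at this
      exact congrArg Subtype.val this
    · intro x
      refine ⟨(par x).1, (par x).2, ?_⟩
      rw [hpar2 _ (par x).2]
    · intro x y
      by_cases hx : (G.neighborSet x).ncard = 1 <;> by_cases hy : (G.neighborSet y).ncard = 1
      · simp only [hmem, hx, hy, ne_eq, not_true_eq_false, not_false_eq_true,
          false_and, and_false, and_true, and_self, or_self]
        simpa only [iff_false] using fun h => hpair x y h hx hy
      · have h1 : G.Adj x y ↔ par x = par y := by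
          rw [hpar2 y hy]
          refine ⟨fun h => Subtype.ext (huniq _ _ _ hx (hpar1 x hx) h), fun h => ?_⟩
          have := hpar1 x hx
          rwa [h] at this
        rw [h1]
        simp only [hmem, hx, hy, ne_eq, not_true_eq_false, not_false_eq_true,
          true_and, false_and, false_or, and_true, and_self]
        exact ⟨fun h => by rw [h], fun h => hposinj x y h⟩
      · have h1 : G.Adj x y ↔ par x = par y := by
          rw [hpar2 x hx, G.adj_comm]
          refine ⟨fun h => Subtype.ext (huniq _ _ _ hy h (hpar1 y hy)), fun h => ?_⟩
          have := hpar1 y hy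
          rwa [← h] at this
        rw [h1]
        simp only [hmem, hx, hy, ne_eq, not_true_eq_false, not_false_eq_true,
          false_and, and_false, or_false, false_or, and_true, and_self]
        exact ⟨fun h => by rw [h], fun h => hposinj x y h⟩
      · have h1 : G.Adj x y ↔ (SimpleGraph.pathGraph n).Adj (e (par x)) (e (par y)) := by
          rw [e.map_adj_iff, hpar2 x hx, hpar2 y hy]
          rfl
        rw [h1, SimpleGraph.pathGraph_adj]
        simp only [hmem, hx, hy, ne_eq, not_true_eq_false, not_false_eq_true,
          true_and, and_false, or_false, and_true, or_self]

/-- Layouts of the components, placed one after the other with gaps in between. -/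
lemma IsCaterpillarForest.nonempty_spineLayout [Finite V] {G : SimpleGraph V}
    (hG : IsCaterpillarForest G) : Nonempty (SpineLayout G) := by
  classical
  obtain ⟨L⟩ : Nonempty (∀ c : G.ConnectedComponent, SpineLayout (G.induce c.supp)) :=
    ⟨fun c => (hG c).nonempty_spineLayout.some⟩
  obtain ⟨m, ⟨idx⟩⟩ := Finite.exists_equiv_fin G.ConnectedComponent
  let lpos : V → ℕ := fun x => (L (G.connectedComponentMk x)).pos ⟨x, rfl⟩
  obtain ⟨N, hN⟩ : ∃ N, ∀ x, lpos x < N := by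
    obtain ⟨N, hN⟩ := (Set.finite_range lpos).bddAbove
    exact ⟨N + 1, fun x => Nat.lt_succ_of_le (hN ⟨x, rfl⟩)⟩
  let pos : V → ℕ := fun x => lpos x + (N + 1) * idx (G.connectedComponentMk x)
  let spine : Set V := {x | ⟨x, rfl⟩ ∈ (L (G.connectedComponentMk x)).spine}
  have hlpos : ∀ c (x : c.supp), lpos x.1 = (L c).pos x := by
    rintro c ⟨x, rfl⟩
    rfl
  have hspine : ∀ c (x : c.supp), x.1 ∈ spine ↔ x ∈ (L c).spine := by
    rintro c ⟨x, rfl⟩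
    rfl
  have hpos : ∀ x y, pos x ≤ pos y + 1 → pos y ≤ pos x + 1 →
      G.connectedComponentMk x = G.connectedComponentMk y := by
    intro x y h1 h2
    have hx := hN x
    have hy := hN y
    apply idx.injective
    apply Fin.ext
    simp only [pos] at h1 h2
    rcases Nat.lt_trichotomy (idx (G.connectedComponentMk x) : ℕ)
      (idx (G.connectedComponentMk y)) with h | h | h
    · have := Nat.mul_le_mul_left (N + 1) h
      rw [Nat.succ_eq_add_one, mul_add] at this
      omega
    · exact h
    · have := Nat.mul_le_mul_left (N + 1) h
      rw [Nat.succ_eq_add_one, mul_add] at this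
      omega
  have hpos_eq : ∀ c (x y : c.supp), ∀ a b : ℕ,
      pos x.1 + a = pos y.1 + b ↔ (L c).pos x + a = (L c).pos y + b := by
    rintro c x y a b
    have hx : G.connectedComponentMk x.1 = c := x.2
    have hy : G.connectedComponentMk y.1 = c := y.2
    simp only [pos, hx, hy, hlpos]
    omega
  refine ⟨{ spine := spine, pos := pos, inj := ?_, parent := ?_, adj_iff := ?_ }⟩
  · intro p hp q hq h
    have hc := hpos p q (by omega) (by omega)
    let p' : (G.connectedComponentMk q).supp := ⟨p, hc⟩
    let q' : (G.connectedComponentMk q).supp := ⟨q, rfl⟩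
    exact congrArg Subtype.val ((L _).inj p' ((hspine _ p').1 hp) q' ((hspine _ q').1 hq)
      ((hpos_eq _ p' q' 0 0).1 h))
  · intro x
    obtain ⟨p, hp, hpx⟩ := (L (G.connectedComponentMk x)).parent ⟨x, rfl⟩
    exact ⟨p.1, (hspine _ p).2 hp, (hpos_eq _ p ⟨x, rfl⟩ 0 0).2 hpx⟩
  · intro x y
    by_cases hc : G.connectedComponentMk x = G.connectedComponentMk y
    · let x' : (G.connectedComponentMk y).supp := ⟨x, hc⟩
      let y' : (G.connectedComponentMk y).supp := ⟨y, rfl⟩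
      have h := (L _).adj_iff x' y'
      have h1 : pos x + 1 = pos y ↔ _ := hpos_eq _ x' y' 1 0
      have h2 : pos y + 1 = pos x ↔ _ := hpos_eq _ y' x' 1 0
      have h3 : pos x = pos y ↔ _ := hpos_eq _ x' y' 0 0
      simp only [add_zero] at h1 h2 h3
      rw [← hspine, ← hspine, ← h1, ← h2, ← h3] at h
      exact h
    · constructor
      · exact fun h => absurd (SimpleGraph.ConnectedComponent.sound h.reachable) hc
      · rintro (⟨-, -, h⟩ | ⟨h, -⟩) <;> exact absurd (hpos x y (by omega) (by omega)) hc

/-- Let `G` be a caterpillar forest, `d` a positive integer, and `X`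
a minimal `d`-blocking set of `G`. Then `|X| ≤ 2`. -/
theorem stmt2 {V : Type} [Fintype V] (G : SimpleGraph V)
    (hG : IsCaterpillarForest G) (d : ℕ) (hd : 1 ≤ d)
    (X : Set V) (hX : IsMinimalBlockingSetOn G Set.univ d X) :
    X.ncard ≤ 2 := by
  obtain ⟨L⟩ := hG.nonempty_spineLayout
  exact L.ncard_le_two_of_isMinimalBlockingSetOn hd hX

end CocPaper
end

section
/- Let G be a finite simple graph each of whose connected components is a caterpillar or a cycle, and let d ≥ 1 be an integer. Then every minimal d-blocking set of G has size at most 3. -/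
namespace CocPaper

open SimpleGraph

variable {V : Type} {W : Type}

/-- Every vertex of `T` is reachable from `r` inside `T`, phrased through closed subsets. -/
def ReachesAll (G : SimpleGraph V) (r : V) (T : Set V) : Prop :=
  ∀ U : Set V, r ∈ U → (∀ a ∈ U, a ∈ T → ∀ b ∈ T, G.Adj a b → b ∈ U) → T ⊆ U

/-- Every connected vertex set avoiding `S` has at most `d` elements. -/
def HitsLarge (G : SimpleGraph V) (d : ℕ) (S : Set V) : Prop :=
  ∀ r T, r ∈ T → ReachesAll G r T → (∀ t ∈ T, t ∉ S) → T.ncard ≤ d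

theorem isCocSetOn_univ_iff [Finite V] {G : SimpleGraph V} {d : ℕ} {S : Set V} :
    IsCocSetOn G Set.univ d S ↔ HitsLarge G d S := by
  constructor
  · intro h r T hr hT hd
    have hr' : r ∈ Set.univ \ S := ⟨trivial, hd r hr⟩
    have key : T ⊆ Subtype.val ''
        ((G.induce (Set.univ \ S)).connectedComponentMk ⟨r, hr'⟩).supp := by
      apply hT
      · exact ⟨⟨r, hr'⟩, rfl, rfl⟩
      · rintro _ ⟨a, ha, rfl⟩ _ b hb hab
        refine ⟨⟨b, trivial, hd b hb⟩, ?_, rfl⟩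
        have hab' : (G.induce (Set.univ \ S)).Adj a ⟨b, trivial, hd b hb⟩ := hab
        rw [ConnectedComponent.mem_supp_iff] at ha ⊢
        rw [← ha]
        exact ConnectedComponent.sound hab'.symm.reachable
    refine (Set.ncard_le_ncard key (Set.toFinite _)).trans ?_
    rw [Set.ncard_image_of_injective _ Subtype.val_injective]
    exact h _
  · intro h c
    induction c using ConnectedComponent.ind with | _ r =>
    rw [← Set.ncard_image_of_injective _ Subtype.val_injective]
    refine h r.1 _ ⟨r, rfl, rfl⟩ ?_ ?_
    · rintro U hU hcl _ ⟨a, ha, rfl⟩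
      have ha' : (G.induce (Set.univ \ S)).Reachable r a :=
        (ConnectedComponent.exact ha).symm
      rw [reachable_iff_reflTransGen] at ha'
      induction ha' with
      | refl => exact hU
      | @tail b e hb hbe ih =>
        have hb' : (G.induce (Set.univ \ S)).Reachable r b := by
          rwa [reachable_iff_reflTransGen]
        have hbs := ConnectedComponent.sound hb'.symm
        exact hcl b.1 (ih hbs) ⟨b, hbs, rfl⟩ e.1 ⟨e, ha, rfl⟩ hbe
    · rintro _ ⟨a, _, rfl⟩
      exact a.2.2

/-- A smallest set hitting all connected vertex sets with more than `d` elements. -/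
def IsMinHitting (G : SimpleGraph V) (d : ℕ) (S : Set V) : Prop :=
  HitsLarge G d S ∧ ∀ Y, HitsLarge G d Y → S.ncard ≤ Y.ncard

theorem isMinCocSetOn_univ_iff [Finite V] {G : SimpleGraph V} {d : ℕ} {S : Set V} :
    IsMinCocSetOn G Set.univ d S ↔ IsMinHitting G d S := by
  unfold IsMinCocSetOn IsMinHitting
  rw [isCocSetOn_univ_iff]
  constructor
  · rintro ⟨_, h1, h2⟩
    refine ⟨h1, fun Y hY => ?_⟩
    rw [h2]
    exact Nat.sInf_le ⟨Y, Set.subset_univ _, isCocSetOn_univ_iff.2 hY, rfl⟩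
  · rintro ⟨h1, h2⟩
    refine ⟨Set.subset_univ _, h1, le_antisymm ?_ ?_⟩
    · refine le_csInf ⟨_, S, Set.subset_univ _, isCocSetOn_univ_iff.2 h1, rfl⟩ ?_
      rintro _ ⟨Y, _, hY, rfl⟩
      exact h2 Y (isCocSetOn_univ_iff.1 hY)
    · exact Nat.sInf_le ⟨S, Set.subset_univ _, isCocSetOn_univ_iff.2 h1, rfl⟩

theorem ncard_inter_union_diff [Finite V] (S S' A : Set V) :
    ((S ∩ A) ∪ (S' \ A)).ncard = (S ∩ A).ncard + (S' \ A).ncard :=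
  Set.ncard_union_eq
    (Set.disjoint_left.2 fun _ h h' => h'.2 h.2) (Set.toFinite _) (Set.toFinite _)

theorem HitsLarge.glue {G : SimpleGraph V} {d : ℕ} {S S' A : Set V}
    (hS : HitsLarge G d S) (hS' : HitsLarge G d S')
    (h : ∀ a ∈ A, ∀ b ∉ A, G.Adj a b → a ∈ S ∩ S' ∨ b ∈ S ∩ S') :
    HitsLarge G d ((S ∩ A) ∪ (S' \ A)) := by
  intro r T hr hT hd
  by_cases hrA : r ∈ A
  · have : T ⊆ A := by
      refine hT A hrA fun a ha haT b hb hab => ?_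
      by_contra hbA
      rcases h a ha b hbA hab with h | h
      · exact hd a haT (Or.inl ⟨h.1, ha⟩)
      · exact hd b hb (Or.inr ⟨h.2, hbA⟩)
    exact hS r T hr hT fun t ht hts => hd t ht (Or.inl ⟨hts, this ht⟩)
  · have : T ⊆ Aᶜ := by
      refine hT Aᶜ hrA fun a ha haT b hb hab hbA => ?_
      rcases h b hbA a ha hab.symm with h | h
      · exact hd b hb (Or.inl ⟨h.1, hbA⟩)
      · exact hd a haT (Or.inr ⟨h.2, ha⟩)
    exact hS' r T hr hT fun t ht hts => hd t ht (Or.inr ⟨hts, this ht⟩)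

theorem IsMinHitting.glue [Finite V] {G : SimpleGraph V} {d : ℕ} {S S' A : Set V}
    (hS : IsMinHitting G d S) (hS' : IsMinHitting G d S')
    (h : ∀ a ∈ A, ∀ b ∉ A, G.Adj a b → a ∈ S ∩ S' ∨ b ∈ S ∩ S') :
    IsMinHitting G d ((S ∩ A) ∪ (S' \ A)) := by
  refine ⟨hS.1.glue hS'.1 h, fun Y hY => ?_⟩
  have h1 := hS.2 _ (hS'.1.glue hS.1 (A := A) fun a ha b hb hab => by
    simpa only [Set.inter_comm] using h a ha b hb hab)
  have h2 := hS.2 _ hS'.1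
  have h3 := hS'.2 _ hS.1
  have h4 := hS.2 _ hY
  rw [ncard_inter_union_diff] at h1 ⊢
  have h5 := Set.ncard_inter_add_ncard_sdiff_eq_ncard S A (Set.toFinite _)
  have h6 := Set.ncard_inter_add_ncard_sdiff_eq_ncard S' A (Set.toFinite _)
  omega

theorem ReachesAll.reroot {G : SimpleGraph V} {r w : V} {T : Set V} (hT : ReachesAll G r T)
    (hr : r ∈ T) (hw : w ∈ T) : ReachesAll G w T := by
  intro U hU hcl
  by_cases hrU : r ∈ U
  · exact hT U hrU hcl
  · have : T ⊆ T \ U := hT _ ⟨hr, hrU⟩ fun a ha _ b hb hab =>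
      ⟨hb, fun hbU => ha.2 (hcl b hbU hb a ha.1 hab.symm)⟩
    exact absurd hU (this hw).2

/-- The vertex `v` together with some pendants of it (the vertices outside `L ∪ R`) separates
`L` from `R`. -/
structure IsStarCut (G : SimpleGraph V) (v : V) (L R : Set V) : Prop where
  disj : Disjoint L R
  center_left : v ∉ L
  center_right : v ∉ R
  left : ∀ a ∈ L, ∀ b, G.Adj a b → b ∈ L ∨ b = v
  right : ∀ a ∈ R, ∀ b, G.Adj a b → b ∈ R ∨ b = v
  pendant : ∀ a, a ∉ L → a ∉ R → a ≠ v → G.Adj v a ∧ ∀ b, G.Adj a b → b = v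

namespace IsStarCut

variable {G : SimpleGraph V} {v : V} {L R : Set V}

theorem symm (h : IsStarCut G v L R) : IsStarCut G v R L :=
  ⟨h.disj.symm, h.center_right, h.center_left, h.right, h.left,
    fun a h1 h2 h3 => h.pendant a h2 h1 h3⟩

theorem subset_or_of_center_notMem (h : IsStarCut G v L R) {r : V} {T : Set V}
    (hr : r ∈ T) (hT : ReachesAll G r T) (hv : v ∉ T) : T ⊆ L ∨ T ⊆ R ∨ T ⊆ {r} := by
  by_cases hL : r ∈ L
  · left
    exact hT L hL fun a ha _ b hb hab =>
      (h.left a ha b hab).resolve_right fun e => hv (e ▸ hb)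
  by_cases hR : r ∈ R
  · right; left
    exact hT R hR fun a ha _ b hb hab =>
      (h.right a ha b hab).resolve_right fun e => hv (e ▸ hb)
  · right; right
    refine hT {r} rfl fun a ha _ b hb hab => ?_
    rw [Set.mem_singleton_iff.1 ha] at hab
    exact absurd ((h.pendant r hL hR fun e => hv (e ▸ hr)).2 b hab ▸ hb) hv

/-- A connected set avoiding `v` is small as soon as it is hit on the left by `S` and on the
right by `S'`. -/
theorem ncard_le [Finite V] (h : IsStarCut G v L R) {d : ℕ} (hd : 1 ≤ d) {S S' : Set V}
    (hS : HitsLarge G d S) (hS' : HitsLarge G d S') {r : V} {T : Set V}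
    (hr : r ∈ T) (hT : ReachesAll G r T) (hv : v ∉ T)
    (h1 : ∀ t ∈ T, t ∈ L → t ∉ S) (h2 : ∀ t ∈ T, t ∈ R → t ∉ S') : T.ncard ≤ d := by
  rcases h.subset_or_of_center_notMem hr hT hv with hs | hs | hs
  · exact hS r T hr hT fun t ht => h1 t ht (hs ht)
  · exact hS' r T hr hT fun t ht => h2 t ht (hs ht)
  · exact (Set.ncard_le_ncard hs (Set.toFinite _)).trans (by simpa using hd)

theorem hitsLarge_center [Finite V] (h : IsStarCut G v L R) {d : ℕ} (hd : 1 ≤ d)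
    {S S' : Set V} (hS : HitsLarge G d S) (hS' : HitsLarge G d S') :
    HitsLarge G d (insert v ((S ∩ L) ∪ (S' ∩ R))) := by
  intro r T hr hT hdis
  refine h.ncard_le hd hS hS' hr hT (fun hv => hdis v hv (Or.inl rfl)) ?_ ?_
  · exact fun t ht hL hts => hdis t ht (Or.inr (Or.inl ⟨hts, hL⟩))
  · exact fun t ht hR hts => hdis t ht (Or.inr (Or.inr ⟨hts, hR⟩))

theorem ncard_eq [Finite V] (h : IsStarCut G v L R) (S : Set V) :
    S.ncard = (S ∩ L).ncard + (S ∩ R).ncard + (S \ (L ∪ R)).ncard := by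
  rw [← Set.ncard_inter_add_ncard_sdiff_eq_ncard S (L ∪ R) (Set.toFinite _),
    Set.inter_union_distrib_left, Set.ncard_union_eq _ (Set.toFinite _) (Set.toFinite _)]
  exact h.disj.mono Set.inter_subset_right Set.inter_subset_right

theorem ncard_insert_le [Finite V] (S S' : Set V) :
    (insert v ((S ∩ L) ∪ (S' ∩ R))).ncard ≤ (S ∩ L).ncard + (S' ∩ R).ncard + 1 :=
  (Set.ncard_insert_le _ _).trans (Nat.add_le_add_right (Set.ncard_union_le _ _) 1)

theorem ncard_star_le_one [Finite V] (h : IsStarCut G v L R) {d : ℕ} (hd : 1 ≤ d)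
    {S : Set V} (hS : IsMinHitting G d S) : (S \ (L ∪ R)).ncard ≤ 1 := by
  have h1 := hS.2 _ (h.hitsLarge_center hd hS.1 hS.1)
  have h2 := ncard_insert_le (v := v) (L := L) (R := R) S S
  have h3 := h.ncard_eq S
  omega

theorem eq_of_mem [Finite V] (h : IsStarCut G v L R) {d : ℕ} (hd : 1 ≤ d)
    {S : Set V} (hS : IsMinHitting G d S) {x y : V} (hx : x ∈ S) (hy : y ∈ S)
    (hxL : x ∉ L) (hxR : x ∉ R) (hyL : y ∉ L) (hyR : y ∉ R) : x = y :=
  (Set.ncard_le_one (Set.toFinite _)).1 (h.ncard_star_le_one hd hS) x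
    ⟨hx, fun e => e.elim hxL hxR⟩ y ⟨hy, fun e => e.elim hyL hyR⟩

theorem ncard_inter_right_le [Finite V] (h : IsStarCut G v L R) {d : ℕ} (hd : 1 ≤ d)
    {S S' : Set V} (hS : IsMinHitting G d S) (hS' : IsMinHitting G d S')
    {x : V} (hx : x ∈ S) (hxL : x ∉ L) (hxR : x ∉ R) :
    (S ∩ R).ncard ≤ (S' ∩ R).ncard := by
  have h1 := hS.2 _ (h.hitsLarge_center hd hS.1 hS'.1)
  have h2 := ncard_insert_le (v := v) (L := L) (R := R) S S'
  have h3 := h.ncard_eq S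
  have h4 : 0 < (S \ (L ∪ R)).ncard :=
    (Set.ncard_pos (Set.toFinite _)).2 ⟨x, hx, fun e => e.elim hxL hxR⟩
  omega

theorem inter_subset_of_closed (h : IsStarCut G v L R) {T U : Set V}
    (hT : ReachesAll G v T) (hvU : v ∈ U)
    (hU : ∀ a ∈ U, a = v ∨ a ∈ T ∩ L → ∀ b ∈ T ∩ L, G.Adj a b → b ∈ U) : T ∩ L ⊆ U := by
  have : T ⊆ U ∪ Lᶜ := by
    refine hT _ (Or.inl hvU) fun a ha haT b hb hab => ?_
    by_cases hbL : b ∈ L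
    · left
      by_cases haL : a ∈ L
      · exact hU a (ha.resolve_right fun e => e haL) (Or.inr ⟨haT, haL⟩) b ⟨hb, hbL⟩ hab
      · have e : a = v := (h.left b hbL a hab.symm).resolve_left haL
        exact hU a (e ▸ hvU) (Or.inl e) b ⟨hb, hbL⟩ hab
    · exact Or.inr hbL
  exact fun t ht => (this ht.1).resolve_right fun e => e ht.2

/-- The left part of `T`, the right part of `T'` and the star without `x`. -/
def mix (L R : Set V) (x : V) (T T' : Set V) : Set V :=
  (T ∩ L) ∪ (T' ∩ R) ∪ ((L ∪ R)ᶜ \ {x})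

theorem reachesAll_mix (h : IsStarCut G v L R) {x : V} (hx : x ≠ v) {T T' : Set V}
    (hT : ReachesAll G v T) (hT' : ReachesAll G v T') : ReachesAll G v (mix L R x T T') := by
  intro U hU hcl
  have hv : v ∈ mix L R x T T' :=
    Or.inr ⟨fun e => e.elim h.center_left h.center_right, hx.symm⟩
  rintro t ((ht | ht) | ht)
  · refine h.inter_subset_of_closed hT hU (fun a ha haT b hb hab => ?_) ht
    exact hcl a ha (haT.elim (fun e => e ▸ hv) fun e => Or.inl (Or.inl e)) b
      (Or.inl (Or.inl hb)) hab
  · refine h.symm.inter_subset_of_closed hT' hU (fun a ha haT b hb hab => ?_) ht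
    exact hcl a ha (haT.elim (fun e => e ▸ hv) fun e => Or.inl (Or.inr e)) b
      (Or.inl (Or.inr hb)) hab
  · by_cases e : t = v
    · exact e ▸ hU
    · exact hcl v hU hv t (Or.inr ht)
        (h.pendant t (fun e => ht.1 (Or.inl e)) (fun e => ht.1 (Or.inr e)) e).1

theorem ncard_mix [Finite V] (h : IsStarCut G v L R) (x : V) (T T' : Set V) :
    (mix L R x T T').ncard =
      (T ∩ L).ncard + (T' ∩ R).ncard + ((L ∪ R)ᶜ \ {x}).ncard := by
  have hd : ∀ a ∈ L, a ∉ R := fun a ha hb => Set.disjoint_left.1 h.disj ha hb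
  have e1 : mix L R x T T' ∩ L = T ∩ L := by
    ext a; have := hd a; simp only [mix, Set.mem_inter_iff, Set.mem_union, Set.mem_sdiff,
      Set.mem_compl_iff, Set.mem_singleton_iff]; tauto
  have e2 : mix L R x T T' ∩ R = T' ∩ R := by
    ext a; have := hd a; simp only [mix, Set.mem_inter_iff, Set.mem_union, Set.mem_sdiff,
      Set.mem_compl_iff, Set.mem_singleton_iff]; tauto
  have e3 : mix L R x T T' \ (L ∪ R) = (L ∪ R)ᶜ \ {x} := by
    ext a; simp only [mix, Set.mem_inter_iff, Set.mem_union, Set.mem_sdiff,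
      Set.mem_compl_iff, Set.mem_singleton_iff]; tauto
  rw [h.ncard_eq, e1, e2, e3]

theorem ncard_mix_le [Finite V] (h : IsStarCut G v L R) {d : ℕ} (hd : 1 ≤ d)
    {S : Set V} (hS : IsMinHitting G d S) {x : V} (hx : x ∈ S) (hxv : x ≠ v)
    (hxL : x ∉ L) (hxR : x ∉ R) {T T' : Set V}
    (hT : ReachesAll G v T) (hT' : ReachesAll G v T')
    (hTS : ∀ t ∈ T, t ∈ L → t ∉ S) (hTS' : ∀ t ∈ T', t ∈ R → t ∉ S) :
    (T ∩ L).ncard + (T' ∩ R).ncard + ((L ∪ R)ᶜ \ {x}).ncard ≤ d := by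
  rw [← h.ncard_mix]
  refine hS.1 v _ (Or.inr ⟨fun e => e.elim h.center_left h.center_right, hxv.symm⟩)
    (h.reachesAll_mix hxv hT hT') ?_
  rintro t ((ht | ht) | ht) hts
  · exact hTS t ht.1 ht.2 hts
  · exact hTS' t ht.1 ht.2 hts
  · exact ht.2 (h.eq_of_mem hd hS hts hx (fun e => ht.1 (Or.inl e))
      (fun e => ht.1 (Or.inr e)) hxL hxR)

/-- Two minimum solutions which share a vertex of the star can be glued along the star. -/
theorem glue [Finite V] (h : IsStarCut G v L R) {d : ℕ} (hd : 1 ≤ d)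
    {S S' : Set V} (hS : IsMinHitting G d S) (hS' : IsMinHitting G d S')
    {x : V} (hx : x ∈ S) (hx' : x ∈ S') (hxL : x ∉ L) (hxR : x ∉ R) :
    IsMinHitting G d ((S ∩ Rᶜ) ∪ (S' \ Rᶜ)) := by
  by_cases hxv : x = v
  · refine hS.glue hS' fun a ha b hb hab => Or.inl ?_
    have : a = v := (h.right b (not_not.1 hb) a hab.symm).resolve_left ha
    rw [this, ← hxv]
    exact ⟨hx, hx'⟩
  have r1 := h.ncard_inter_right_le hd hS hS' hx hxL hxR
  have r2 := h.ncard_inter_right_le hd hS' hS hx' hxL hxR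
  have l1 := h.symm.ncard_inter_right_le hd hS hS' hx hxR hxL
  have l2 := h.symm.ncard_inter_right_le hd hS' hS hx' hxR hxL
  have hcard : ((S ∩ Rᶜ) ∪ (S' \ Rᶜ)).ncard = S.ncard := by
    have h5 := Set.ncard_inter_add_ncard_sdiff_eq_ncard S R (Set.toFinite _)
    rw [ncard_inter_union_diff, Set.sdiff_compl, ← Set.sdiff_eq]
    omega
  suffices hH : HitsLarge G d ((S ∩ Rᶜ) ∪ (S' \ Rᶜ)) from
    ⟨hH, fun Y hY => hcard ▸ hS.2 Y hY⟩
  by_contra hH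
  have hLR : ∀ a ∈ L, a ∉ R := fun a ha hb => Set.disjoint_left.1 h.disj ha hb
  have hW : ¬ HitsLarge G d ((S' ∩ L) ∪ (S ∩ R)) := by
    intro hW
    have h1 := hS.2 _ hW
    have h2 := Set.ncard_union_le (S' ∩ L) (S ∩ R)
    have h3 := h.ncard_eq S
    have h4 : 0 < (S \ (L ∪ R)).ncard :=
      (Set.ncard_pos (Set.toFinite _)).2 ⟨x, hx, fun e => e.elim hxL hxR⟩
    omega
  simp only [HitsLarge, not_forall, not_le] at hH hW
  obtain ⟨r, T, hr, hT, hTd, hTc⟩ := hH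
  obtain ⟨r', T', hr', hT', hTd', hTc'⟩ := hW
  have a1 : ∀ t ∈ T, t ∈ L → t ∉ S := fun t ht hL hs => hTd t ht (Or.inl ⟨hs, hLR t hL⟩)
  have a2 : ∀ t ∈ T, t ∈ R → t ∉ S' := fun t ht hR hs => hTd t ht (Or.inr ⟨hs, not_not.2 hR⟩)
  have a3 : ∀ t ∈ T', t ∈ L → t ∉ S' := fun t ht hL hs => hTd' t ht (Or.inl ⟨hs, hL⟩)
  have a4 : ∀ t ∈ T', t ∈ R → t ∉ S := fun t ht hR hs => hTd' t ht (Or.inr ⟨hs, hR⟩)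
  have hv : v ∈ T := by
    by_contra hv
    exact absurd (h.ncard_le hd hS.1 hS'.1 hr hT hv a1 a2) (not_le.2 hTc)
  have hv' : v ∈ T' := by
    by_contra hv
    exact absurd (h.ncard_le hd hS'.1 hS.1 hr' hT' hv a3 a4) (not_le.2 hTc')
  have hT := hT.reroot hr hv
  have hT' := hT'.reroot hr' hv'
  have m1 := h.ncard_mix_le hd hS hx hxv hxL hxR hT hT' a1 a4
  have m2 := h.ncard_mix_le hd hS' hx' hxv hxL hxR hT' hT a3 a2
  have t1 := h.ncard_eq T
  have t2 := h.ncard_eq T'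
  have p1 : (T \ (L ∪ R)).ncard ≤ ((L ∪ R)ᶜ \ {x}).ncard := by
    refine Set.ncard_le_ncard (fun t ht => ⟨ht.2, ?_⟩) (Set.toFinite _)
    rintro rfl
    exact hTd t ht.1 (Or.inl ⟨hx, hxR⟩)
  have p2 : (T' \ (L ∪ R)).ncard ≤ ((L ∪ R)ᶜ \ {x}).ncard + 1 := by
    refine (Set.ncard_le_ncard (t := insert x ((L ∪ R)ᶜ \ {x})) (fun t ht => ?_)
      (Set.toFinite _)).trans (Set.ncard_insert_le _ _)
    by_cases e : t = x
    · exact Or.inl e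
    · exact Or.inr ⟨ht.2, e⟩
  omega

end IsStarCut

theorem IsMinimalBlockingSetOn.exists_isMinHitting [Finite V] {G : SimpleGraph V} {d : ℕ}
    {X : Set V} (hX : IsMinimalBlockingSetOn G Set.univ d X) {Y : Set V} (hY : Y ⊂ X) :
    ∃ S, IsMinHitting G d S ∧ Y ⊆ S := by
  have := hX.2 Y hY
  simp only [IsBlockingSetOn, not_forall, not_not] at this
  obtain ⟨S, hS, hYS⟩ := this
  exact ⟨S, isMinCocSetOn_univ_iff.1 hS, hYS⟩

theorem IsMinimalBlockingSetOn.exists_not_glue [Finite V] {G : SimpleGraph V} {d : ℕ}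
    {X : Set V} (hX : IsMinimalBlockingSetOn G Set.univ d X) {A : Set V} {a b : V}
    (ha : a ∈ X) (haA : a ∈ A) (hb : b ∈ X) (hbA : b ∉ A) :
    ∃ S S', IsMinHitting G d S ∧ IsMinHitting G d S' ∧ X \ {b} ⊆ S ∧ X \ {a} ⊆ S' ∧
      ¬ IsMinHitting G d ((S ∩ A) ∪ (S' \ A)) := by
  obtain ⟨S, hS, hbS⟩ := hX.exists_isMinHitting (Set.sdiff_singleton_ssubset.2 hb)
  obtain ⟨S', hS', haS⟩ := hX.exists_isMinHitting (Set.sdiff_singleton_ssubset.2 ha)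
  refine ⟨S, S', hS, hS', hbS, haS, fun h => ?_⟩
  refine hX.1 _ (isMinCocSetOn_univ_iff.2 h) fun y hy => ?_
  by_cases hyA : y ∈ A
  · exact Or.inl ⟨hbS ⟨hy, fun e => hbA (Set.mem_singleton_iff.1 e ▸ hyA)⟩, hyA⟩
  · exact Or.inr ⟨haS ⟨hy, fun e => hyA (Set.mem_singleton_iff.1 e ▸ haA)⟩, hyA⟩

theorem IsMinimalBlockingSetOn.subset_of_closed [Finite V] {G : SimpleGraph V} {d : ℕ}
    {X : Set V} (hX : IsMinimalBlockingSetOn G Set.univ d X) {C : Set V} {a : V}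
    (hC : ∀ u ∈ C, ∀ w, G.Adj u w → w ∈ C) (ha : a ∈ X) (haC : a ∈ C) : X ⊆ C := by
  intro b hb
  by_contra hbC
  obtain ⟨S, S', hS, hS', -, -, hn⟩ := hX.exists_not_glue ha haC hb hbC
  exact hn (hS.glue hS' fun u hu w hw huw => absurd (hC u hu w huw) hw)

/-- Positions of the vertices of a graph along a spine: `q` sends a vertex to its spine vertex
and `p` gives the position on the spine. -/
structure IsSpineMap {W : Type} (H : SimpleGraph W) (q : W → W) (p : W → ℕ) : Prop where
  pos : ∀ w, p (q w) = p w
  inj : ∀ u w, p u = p w → q u = q w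
  idem : ∀ w, q (q w) = q w
  pendant : ∀ u, q u ≠ u → H.Adj u (q u) ∧ ∀ w, H.Adj u w → w = q u
  spine : ∀ u w, q u = u → q w = w → H.Adj u w → p u = p w + 1 ∨ p w = p u + 1

theorem IsCaterpillar.exists_isSpineMap {W : Type} {H : SimpleGraph W}
    (hH : IsCaterpillar H) :
    (∃ a b : W, ∀ w, w = a ∨ w = b) ∨ ∃ q p, IsSpineMap H q p := by
  classical
  obtain ⟨ht, n, ⟨φ⟩⟩ := hH
  by_cases hpair : ∃ a b, (H.neighborSet a).ncard = 1 ∧ (H.neighborSet b).ncard = 1 ∧ H.Adj a b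
  · left
    obtain ⟨a, b, ha, hb, hab⟩ := hpair
    refine ⟨a, b, fun w => ?_⟩
    obtain ⟨a', ha'⟩ := Set.ncard_eq_one.1 ha
    obtain ⟨b', hb'⟩ := Set.ncard_eq_one.1 hb
    have ea : ∀ w, H.Adj a w → w = b := fun w hw => by
      have h1 : w ∈ H.neighborSet a := hw
      have h2 : b ∈ H.neighborSet a := hab
      rw [ha'] at h1 h2
      exact h1.trans h2.symm
    have eb : ∀ w, H.Adj b w → w = a := fun w hw => by
      have h1 : w ∈ H.neighborSet b := hw
      have h2 : a ∈ H.neighborSet b := hab.symm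
      rw [hb'] at h1 h2
      exact h1.trans h2.symm
    have hr := ht.connected.preconnected a w
    rw [reachable_iff_reflTransGen] at hr
    induction hr with
    | refl => exact Or.inl rfl
    | tail _ hadj ih =>
      rcases ih with rfl | rfl
      · exact Or.inr (ea _ hadj)
      · exact Or.inl (eb _ hadj)
  right
  push Not at hpair
  have hq : ∀ u, ∃ w, (H.neighborSet w).ncard ≠ 1 ∧ ((H.neighborSet u).ncard ≠ 1 → w = u) ∧
      ((H.neighborSet u).ncard = 1 → H.Adj u w ∧ ∀ z, H.Adj u z → z = w) := by
    intro u
    by_cases hu : (H.neighborSet u).ncard = 1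
    · obtain ⟨w, hw⟩ := Set.ncard_eq_one.1 hu
      have huw : H.Adj u w := by
        have : w ∈ H.neighborSet u := by rw [hw]; rfl
        exact this
      refine ⟨w, fun h => hpair u w hu h huw, fun h => absurd hu h, fun _ => ⟨huw, fun z hz => ?_⟩⟩
      have : z ∈ H.neighborSet u := hz
      rw [hw] at this
      exact this
    · exact ⟨u, hu, fun _ => rfl, fun h => absurd h hu⟩
  choose q hq1 hq2 hq3 using hq
  have hqs : ∀ u, q u ≠ u → (H.neighborSet u).ncard = 1 := fun u hu => by
    by_contra h
    exact hu (hq2 u h)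
  have hidem : ∀ u, q (q u) = q u := fun u => hq2 _ (hq1 u)
  refine ⟨q, fun u => (φ ⟨q u, hq1 u⟩ : ℕ), ⟨fun w => ?_, fun u w h => ?_, hidem,
    fun u hu => hq3 u (hqs u hu), fun u w hu hw huw => ?_⟩⟩
  · simp only [hidem]
  · have := φ.injective (Fin.ext h)
    exact congrArg Subtype.val this
  · have hadj : (pathGraph n).Adj (φ ⟨q u, hq1 u⟩) (φ ⟨q w, hq1 w⟩) := by
      rw [φ.map_adj_iff]
      change H.Adj (q u) (q w)
      rwa [hu, hw]
    rw [pathGraph_adj] at hadj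
    omega

theorem IsSpineMap.adj {W : Type} {H : SimpleGraph W} {q : W → W} {p : W → ℕ}
    (h : IsSpineMap H q p) {u w : W} (huw : H.Adj u w) :
    p u = p w ∨ (q u = u ∧ q w = w ∧ (p u = p w + 1 ∨ p w = p u + 1)) := by
  by_cases hu : q u = u
  · by_cases hw : q w = w
    · exact Or.inr ⟨hu, hw, h.spine u w hu hw huw⟩
    · left
      rw [(h.pendant w hw).2 u huw.symm, h.pos]
  · left
    rw [(h.pendant u hu).2 w huw, h.pos]

theorem IsSpineMap.isStarCut {G : SimpleGraph V} {C : Set V}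
    (hC : ∀ u ∈ C, ∀ w, G.Adj u w → w ∈ C) {q : C → C} {p : C → ℕ}
    (h : IsSpineMap (G.induce C) q p) (x : C) :
    IsStarCut G (q x) {u | ∃ hu : u ∈ C, p ⟨u, hu⟩ < p x}
      {u | ∀ hu : u ∈ C, p x < p ⟨u, hu⟩} := by
  have hadj : ∀ a b (ha : a ∈ C) (hb : b ∈ C), G.Adj a b → p ⟨a, ha⟩ ≠ p x →
      (p ⟨a, ha⟩ < p x ↔ p ⟨b, hb⟩ < p x) ∧ p ⟨b, hb⟩ ≠ p x ∨ b = q x := by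
    intro a b ha hb hab hne
    by_cases hbx : p ⟨b, hb⟩ = p x
    · right
      rcases h.adj (u := ⟨a, ha⟩) (w := ⟨b, hb⟩) hab with h1 | ⟨_, h2, _⟩
      · omega
      · rw [← h.inj _ _ hbx, h2]
    · left
      rcases h.adj (u := ⟨a, ha⟩) (w := ⟨b, hb⟩) hab with h1 | ⟨_, _, h1⟩ <;> omega
  refine ⟨?_, ?_, ?_, ?_, ?_, ?_⟩
  · rw [Set.disjoint_left]
    rintro a ⟨ha, h1⟩ h2
    exact absurd (h2 ha) (by omega)
  · rintro ⟨_, h1⟩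
    rw [Subtype.coe_eta, h.pos] at h1
    omega
  · intro h1
    have := h1 (q x).2
    rw [Subtype.coe_eta, h.pos] at this
    omega
  · rintro a ⟨ha, h1⟩ b hab
    have hb := hC a ha b hab
    exact (hadj a b ha hb hab h1.ne).imp_left fun h2 => ⟨hb, h2.1.1 h1⟩
  · intro a h1 b hab
    by_cases hb : b ∈ C
    · have ha := hC b hb a hab.symm
      have h3 := h1 ha
      refine (hadj a b ha hb hab h3.ne').imp_left fun h2 _ => ?_
      omega
    · exact Or.inl fun e => absurd e hb
  · intro a h1 h2 h3
    simp only [Set.mem_ofPred_eq, not_exists, not_forall, not_lt] at h1 h2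
    obtain ⟨ha, h2⟩ := h2
    have e := h.inj ⟨a, ha⟩ x (le_antisymm h2 (h1 ha))
    have hne : q ⟨a, ha⟩ ≠ ⟨a, ha⟩ := fun hh => h3 (by rw [← e, hh])
    obtain ⟨h4, h5⟩ := h.pendant _ hne
    rw [e] at h4 h5
    exact ⟨SimpleGraph.Adj.symm h4, fun b hab => congrArg Subtype.val (h5 ⟨b, hC a ha b hab⟩ hab)⟩

/-- Four elements of a large set, in increasing order of an injective labelling. -/
theorem exists_four_increasing {W : Type} [Finite W] {X : Set W} (hX : 4 ≤ X.ncard)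
    {p : W → ℕ} (hp : Set.InjOn p X) :
    ∃ a ∈ X, ∃ b ∈ X, ∃ c ∈ X, ∃ e ∈ X, p a < p b ∧ p b < p c ∧ p c < p e := by
  rw [← hp.ncard_image, Set.ncard_eq_toFinset_card (p '' X) (Set.toFinite _)] at hX
  let f := Finset.orderEmbOfCardLe _ hX
  have hf : ∀ i, ∃ a ∈ X, p a = f i := fun i => by
    simpa using Finset.orderEmbOfCardLe_mem _ hX i
  choose g hg1 hg2 using hf
  refine ⟨_, hg1 0, _, hg1 1, _, hg1 2, _, hg1 3, ?_, ?_, ?_⟩ <;>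
  · rw [hg2, hg2]
    exact f.strictMono (by decide)

theorem IsMinimalBlockingSetOn.ncard_le_of_isSpineMap [Finite V] {G : SimpleGraph V} {d : ℕ}
    (hd : 1 ≤ d) {X : Set V} (hX : IsMinimalBlockingSetOn G Set.univ d X) {C : Set V}
    (hC : ∀ u ∈ C, ∀ w, G.Adj u w → w ∈ C) (hXC : X ⊆ C) {q : C → C} {p : C → ℕ}
    (h : IsSpineMap (G.induce C) q p) : X.ncard ≤ 3 := by
  by_contra! hcard
  have hcard' : 4 ≤ (Subtype.val ⁻¹' X : Set C).ncard := by
    rw [Set.ncard_preimage_of_injective_subset_range Subtype.val_injective (by simpa using hXC)]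
    exact hcard
  have hinj : Set.InjOn p (Subtype.val ⁻¹' X : Set C) := by
    intro x hx y hy hxy
    have hlt : ({x.1, y.1} : Set V).ncard < X.ncard :=
      (Set.ncard_insert_le _ _).trans_lt (by rw [Set.ncard_singleton]; omega)
    have hss : ({x.1, y.1} : Set V) ⊂ X := by
      refine ⟨by rintro z (rfl | rfl) <;> assumption, fun e => ?_⟩
      exact absurd (Set.ncard_le_ncard e (Set.toFinite _)) (not_le.2 hlt)
    obtain ⟨S, hS, hsub⟩ := hX.exists_isMinHitting hss
    refine Subtype.ext ((h.isStarCut hC x).eq_of_mem hd hS (hsub (Or.inl rfl))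
      (hsub (Or.inr rfl)) ?_ ?_ ?_ ?_)
    · rintro ⟨_, h1⟩
      exact h1.ne rfl
    · exact fun h1 => (h1 x.2).ne rfl
    · rintro ⟨_, h1⟩
      exact h1.ne hxy.symm
    · exact fun h1 => (h1 y.2).ne hxy
  obtain ⟨a, ha, x, hx, b, hb, -, -, h1, h2, -⟩ := exists_four_increasing hcard' hinj
  obtain ⟨S, S', hS, hS', hbS, haS, hn⟩ := hX.exists_not_glue
    (A := {u | ∀ hu : u ∈ C, p x < p ⟨u, hu⟩}ᶜ) (a := a) (b := b) ha
    (fun e => absurd (e a.2) (not_lt.2 h1.le)) hb (not_not.2 fun _ => h2)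
  have hxb : x.1 ≠ b := fun e => h2.ne (congrArg p (Subtype.ext e))
  have hxa : x.1 ≠ a := fun e => h1.ne' (congrArg p (Subtype.ext e))
  refine hn ((h.isStarCut hC x).glue hd hS hS' (hbS ⟨hx, hxb⟩) (haS ⟨hx, hxa⟩) ?_ ?_)
  · rintro ⟨_, h1⟩
    exact h1.ne rfl
  · exact fun h1 => (h1 x.2).ne rfl

theorem IsCycleGraph.exists_pos {W : Type} {H : SimpleGraph W} (hH : IsCycleGraph H) :
    ∃ (n : ℕ) (p : W → ℕ), Function.Injective p ∧ (∀ w, p w < n) ∧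
      ∀ u w, H.Adj u w → p u = p w + 1 ∨ p w = p u + 1 ∨
        (p u = 0 ∧ p w + 1 = n) ∨ (p w = 0 ∧ p u + 1 = n) := by
  obtain ⟨n, hn, ⟨φ⟩⟩ := hH
  obtain ⟨m, rfl⟩ : ∃ m, n = m + 1 := ⟨n - 1, by omega⟩
  refine ⟨m + 1, fun w => (φ w : ℕ), fun u w h => φ.injective (Fin.ext h), fun w => (φ w).2,
    fun u w huw => ?_⟩
  have hadj := φ.map_adj_iff.2 huw
  rw [cycleGraph_adj'] at hadj
  have h1 := (φ u).2
  have h2 := (φ w).2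
  rw [Fin.val_sub, Fin.val_sub] at hadj
  have key : ∀ s t : ℕ, s < m + 1 → t < m + 1 → (m + 1 - t + s) % (m + 1) = 1 →
      s = t + 1 ∨ (s = 0 ∧ t + 1 = m + 1) := by
    intro s t hs ht h
    by_cases hst : t ≤ s
    · rw [show m + 1 - t + s = (s - t) + (m + 1) by omega, Nat.add_mod_right,
        Nat.mod_eq_of_lt (by omega)] at h
      omega
    · rw [Nat.mod_eq_of_lt (by omega)] at h
      omega
  rcases hadj with hadj | hadj
  · have := key _ _ h1 h2 hadj
    tauto
  · have := key _ _ h2 h1 hadj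
    tauto

theorem IsMinimalBlockingSetOn.ncard_le_of_isCycleGraph [Finite V] {G : SimpleGraph V} {d : ℕ}
    {X : Set V} (hX : IsMinimalBlockingSetOn G Set.univ d X) {C : Set V}
    (hC : ∀ u ∈ C, ∀ w, G.Adj u w → w ∈ C) (hXC : X ⊆ C)
    (h : IsCycleGraph (G.induce C)) : X.ncard ≤ 3 := by
  by_contra! hcard
  have hcard' : 4 ≤ (Subtype.val ⁻¹' X : Set C).ncard := by
    rw [Set.ncard_preimage_of_injective_subset_range Subtype.val_injective (by simpa using hXC)]
    exact hcard
  obtain ⟨n, p, hinj, hlt, hadj⟩ := h.exists_pos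
  obtain ⟨x, hx, a, ha, y, hy, b, hb, h1, h2, h3⟩ := exists_four_increasing hcard' hinj.injOn
  obtain ⟨S, S', hS, hS', hbS, haS, hn⟩ := hX.exists_not_glue
    (A := {u | ∃ hu : u ∈ C, p x ≤ p ⟨u, hu⟩ ∧ p ⟨u, hu⟩ ≤ p y}) (a := a) (b := b) ha
    ⟨a.2, h1.le, h2.le⟩ hb (fun e => absurd e.2.2 (not_le.2 h3))
  have hne : ∀ u w : C, p u ≠ p w → u.1 ≠ w := fun u w h e => h (congrArg p (Subtype.ext e))
  refine hn (hS.glue hS' ?_)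
  rintro u ⟨hu, hu1, hu2⟩ w hw huw
  left
  have hwC := hC u hu w huw
  have hw' : ¬ (p x ≤ p ⟨w, hwC⟩ ∧ p ⟨w, hwC⟩ ≤ p y) := fun e => hw ⟨hwC, e⟩
  have hcyc := hadj ⟨u, hu⟩ ⟨w, hwC⟩ huw
  have hb' := hlt b
  have : p ⟨u, hu⟩ = p x ∨ p ⟨u, hu⟩ = p y := by omega
  rcases this with e | e
  · have : u = x := congrArg Subtype.val (hinj e)
    subst this
    exact ⟨hbS ⟨hx, hne _ _ (by omega)⟩, haS ⟨hx, hne _ _ (by omega)⟩⟩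
  · have : u = y := congrArg Subtype.val (hinj e)
    subst this
    exact ⟨hbS ⟨hy, hne _ _ (by omega)⟩, haS ⟨hy, hne _ _ (by omega)⟩⟩

/-- Let `G` be a finite simple graph each of whose connected components
is a caterpillar or a cycle, and `d ≥ 1`. Then every minimal `d`-blocking set of `G`
has size at most `3`. -/
theorem stmt3 {V : Type} [Fintype V] (G : SimpleGraph V)
    (hG : ∀ c : G.ConnectedComponent,
      IsCaterpillar (G.induce c.supp) ∨ IsCycleGraph (G.induce c.supp))
    (d : ℕ) (hd : 1 ≤ d)
    (X : Set V) (hX : IsMinimalBlockingSetOn G Set.univ d X) :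
    X.ncard ≤ 3 := by
  rcases X.eq_empty_or_nonempty with rfl | ⟨a, ha⟩
  · simp
  have hC : ∀ u ∈ (G.connectedComponentMk a).supp, ∀ w, G.Adj u w →
      w ∈ (G.connectedComponentMk a).supp := fun u hu w huw =>
    (ConnectedComponent.sound huw.symm.reachable).trans hu
  have hXC := hX.subset_of_closed hC ha rfl
  rcases hG (G.connectedComponentMk a) with h | h
  · rcases h.exists_isSpineMap with ⟨u, w, huw⟩ | ⟨q, p, h⟩
    · have hsub : X ⊆ {u.1, w.1} := fun z hz =>
        (huw ⟨z, hXC hz⟩).imp (congrArg Subtype.val) (congrArg Subtype.val)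
      refine (Set.ncard_le_ncard hsub (Set.toFinite _)).trans ((Set.ncard_insert_le _ _).trans ?_)
      rw [Set.ncard_singleton]
      omega
    · exact hX.ncard_le_of_isSpineMap hd hC hXC h
  · exact hX.ncard_le_of_isCycleGraph hC hXC h

end CocPaper
end

section
/- Let d ≥ 1 be an integer. Every caterpillar forest (with a fixed spine and spine order for each component) has exactly one solution-tight packing. -/
namespace CocPaper

open SimpleGraph

variable {V : Type} {W : Type}

lemma subset_of_connected_of_closed {G : SimpleGraph V} {A T : Set V}
    (hA : (G.induce A).Connected) {x : V} (hxA : x ∈ A) (hxT : x ∈ T)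
    (hT : ∀ u ∈ T, u ∈ A → ∀ v ∈ A, G.Adj u v → v ∈ T) : A ⊆ T := by
  intro y hy
  obtain ⟨p⟩ := hA.preconnected ⟨x, hxA⟩ ⟨y, hy⟩
  have key : ∀ (u v : A), (G.induce A).Walk u v → (u : V) ∈ T → (v : V) ∈ T := by
    intro u v p
    induction p with
    | nil => exact id
    | cons h _ ih => exact fun hu => ih (hT _ hu (Subtype.prop _) _ (Subtype.prop _) h)
  exact key _ _ p hxT

lemma isCocSetOn_of_closed [Finite V] {G : SimpleGraph V} {A S : Set V} {d : ℕ}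
    (h : ∀ v ∈ A \ S, ∃ T : Set V, v ∈ T ∧ T.ncard ≤ d ∧
      ∀ x ∈ T, ∀ y ∈ A \ S, G.Adj x y → y ∈ T) : IsCocSetOn G A d S := by
  intro c
  induction c using SimpleGraph.ConnectedComponent.ind with
  | h v =>
    obtain ⟨T, hvT, hTd, hT⟩ := h v v.2
    refine le_trans ?_ hTd
    refine Set.ncard_le_ncard_of_injOn Subtype.val ?_ Subtype.val_injective.injOn (Set.toFinite T)
    intro w hw
    obtain ⟨p⟩ := (SimpleGraph.ConnectedComponent.exact hw).symm
    have key : ∀ (u v : ↥(A \ S)), (G.induce (A \ S)).Walk u v → (u : V) ∈ T → (v : V) ∈ T := by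
      intro u v p
      induction p with
      | nil => exact id
      | cons h _ ih => exact fun hu => ih (hT _ hu _ (Subtype.prop _) h)
    exact key _ _ p hvT

lemma IsCocSetOn.ncard_le [Finite V] {G : SimpleGraph V} {A S T : Set V} {d : ℕ}
    (h : IsCocSetOn G A d S) (hTA : T ⊆ A \ S) (hT : (G.induce T).Connected) :
    T.ncard ≤ d := by
  obtain ⟨⟨v, hv⟩⟩ := hT.nonempty
  refine le_trans ?_ (h ((G.induce (A \ S)).connectedComponentMk ⟨v, hTA hv⟩))
  have : T ⊆ Subtype.val ''
      ((G.induce (A \ S)).connectedComponentMk ⟨v, hTA hv⟩).supp := by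
    intro w hw
    refine ⟨⟨w, hTA hw⟩, ?_, rfl⟩
    exact SimpleGraph.ConnectedComponent.sound
      ((hT.preconnected ⟨w, hw⟩ ⟨v, hv⟩).map (SimpleGraph.induceHomOfLE G hTA).toHom)
  exact (Set.ncard_le_ncard this (Set.toFinite _)).trans (Set.ncard_image_le (Set.toFinite _))

lemma card_packing_le_ncard [Finite V] {G : SimpleGraph V} {A S : Set V} {d : ℕ}
    (hS : IsCocSetOn G A d S) {P : Finset (Set V)}
    (hP : ∀ B ∈ P, B ⊆ A ∧ d + 1 ≤ B.ncard ∧ (G.induce B).Connected)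
    (hdisj : ((↑P : Set (Set V)).Pairwise fun B B' => Disjoint B B')) :
    P.card ≤ S.ncard := by
  have hit : ∀ B ∈ P, ∃ s ∈ S, s ∈ B := by
    intro B hB
    obtain ⟨hBA, hBd, hBc⟩ := hP B hB
    by_contra! hno
    have := hS.ncard_le (fun s hs => ⟨hBA hs, fun h => hno s h hs⟩) hBc
    omega
  rcases P.eq_empty_or_nonempty with rfl | ⟨B₀, hB₀⟩
  · simp
  have : Nonempty V := ⟨(hit B₀ hB₀).choose⟩
  choose! f hfS hfB using hit
  rw [← Set.ncard_coe_finset]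
  refine Set.ncard_le_ncard_of_injOn f hfS ?_ (Set.toFinite S)
  intro B hB B' hB' hBB'
  by_contra hne
  exact Set.disjoint_left.mp (hdisj hB hB' hne) (hfB B hB) (hBB' ▸ hfB B' hB')

namespace SubCaterpillar

variable {G : SimpleGraph V} (C : SubCaterpillar G)

lemma eq_of_pendant {v x y : V} (hv : v ∈ C.verts) (hvs : v ∉ Set.range C.spine)
    (hx : x ∈ C.verts) (hy : y ∈ C.verts) (hvx : G.Adj v x) (hvy : G.Adj v y) : x = y := by
  obtain ⟨w, hw⟩ := Set.ncard_eq_one.mp (C.pendant v hv hvs)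
  have hx' : x ∈ ({w} : Set V) := hw ▸ ⟨hx, hvx⟩
  have hy' : y ∈ ({w} : Set V) := hw ▸ ⟨hy, hvy⟩
  exact hx'.trans hy'.symm

lemma exists_spine_adj {v : V} (hv : v ∈ C.verts) (hvs : v ∉ Set.range C.spine) :
    ∃ j, G.Adj v (C.spine j) := by
  obtain ⟨w, hw⟩ := Set.ncard_eq_one.mp (C.pendant v hv hvs)
  obtain ⟨hwC, hvw⟩ : w ∈ {w | w ∈ C.verts ∧ G.Adj v w} := hw ▸ rfl
  by_cases hws : w ∈ Set.range C.spine
  · obtain ⟨j, rfl⟩ := hws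
    exact ⟨j, hvw⟩
  · have hsub : C.verts ⊆ {v, w} := by
      refine subset_of_connected_of_closed C.isTree.connected hv (Or.inl rfl) ?_
      rintro u (rfl | rfl) hu x hx hux
      · exact Or.inr (C.eq_of_pendant hv hvs hx hwC hux hvw)
      · exact Or.inl (C.eq_of_pendant hwC hws hx hv hux hvw.symm)
    rcases hsub (C.spineMem ⟨0, C.npos⟩) with h | h
    · exact absurd ⟨_, h⟩ hvs
    · exact absurd ⟨_, h⟩ hws

lemma pos_spec {v : V} (hv : v ∈ C.verts) : ∃ h : C.pos v < C.n,
    C.spine ⟨C.pos v, h⟩ = v ∨ (v ∉ Set.range C.spine ∧ G.Adj v (C.spine ⟨C.pos v, h⟩)) := by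
  have hne : {i : ℕ | ∃ h : i < C.n,
      C.spine ⟨i, h⟩ = v ∨ (v ∉ Set.range C.spine ∧ G.Adj v (C.spine ⟨i, h⟩))}.Nonempty := by
    by_cases hvs : v ∈ Set.range C.spine
    · obtain ⟨j, hj⟩ := hvs
      exact ⟨j, j.2, Or.inl hj⟩
    · obtain ⟨j, hj⟩ := C.exists_spine_adj hv hvs
      exact ⟨j, j.2, Or.inr ⟨hvs, hj⟩⟩
  exact Nat.sInf_mem hne

lemma pos_lt {v : V} (hv : v ∈ C.verts) : C.pos v < C.n := (C.pos_spec hv).1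

lemma pos_spine (j : Fin C.n) : C.pos (C.spine j) = j := by
  obtain ⟨_, heq | hpendant⟩ := C.pos_spec (C.spineMem j)
  · exact congrArg Fin.val (C.spineInj heq)
  · exact absurd ⟨j, rfl⟩ hpendant.1

/-- The spine vertex at the position of `v`: the vertex itself or its parent. -/
lemma parent_spec {v : V} (hv : v ∈ C.verts) : C.spine ⟨C.pos v, C.pos_lt hv⟩ = v ∨
    (v ∉ Set.range C.spine ∧ G.Adj v (C.spine ⟨C.pos v, C.pos_lt hv⟩)) :=
  (C.pos_spec hv).2

lemma eq_parent_of_adj {v w : V} (hv : v ∈ C.verts) (hvs : v ∉ Set.range C.spine)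
    (hw : w ∈ C.verts) (hvw : G.Adj v w) : w = C.spine ⟨C.pos v, C.pos_lt hv⟩ := by
  rcases C.parent_spec hv with h | h
  · exact absurd ⟨_, h⟩ hvs
  · exact C.eq_of_pendant hv hvs hw (C.spineMem _) hvw h.2

lemma spine_adj_le {i j : Fin C.n} (hij : i < j) (h : G.Adj (C.spine i) (C.spine j)) :
    (j : ℕ) = i + 1 := by
  by_contra hne
  set H := G.induce C.verts
  let s : Fin C.n → C.verts := fun k => ⟨C.spine k, C.spineMem k⟩
  have hs : Function.Injective s := fun a b hab => C.spineInj (congrArg Subtype.val hab)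
  have hadj : H.Adj (s i) (s j) := h
  have hb := SimpleGraph.isAcyclic_iff_forall_adj_isBridge.mp C.isTree.isAcyclic hadj
  rw [SimpleGraph.isBridge_iff] at hb
  apply hb
  have key : ∀ k (hk : k < C.n), (i : ℕ) ≤ k →
      (H \ SimpleGraph.fromEdgeSet {s(s i, s j)}).Reachable (s i) (s ⟨k, hk⟩) := by
    intro k
    induction k with
    | zero =>
      intro hk hik
      have : i = ⟨0, hk⟩ := Fin.ext (by simpa using hik)
      rw [this]
    | succ k ih =>
      intro hk hik
      rcases Nat.lt_or_ge k i with hlt | hle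
      · have : i = ⟨k + 1, hk⟩ := Fin.ext (by simp; omega)
        rw [this]
      · refine (ih (by omega) hle).trans (SimpleGraph.Adj.reachable ?_)
        rw [SimpleGraph.sdiff_adj, SimpleGraph.fromEdgeSet_adj]
        refine ⟨C.spineAdj k hk, ?_⟩
        rintro ⟨he, -⟩
        rw [Set.mem_singleton_iff, Sym2.eq_iff] at he
        rcases he with ⟨h1, h2⟩ | ⟨h1, h2⟩
        · have e1 := congrArg Fin.val (hs h1)
          have e2 := congrArg Fin.val (hs h2)
          simp only at e1 e2
          omega
        · have e1 := congrArg Fin.val (hs h1)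
          have e2 := congrArg Fin.val (hs h2)
          have := Fin.lt_def.mp hij
          simp only at e1 e2
          omega
  exact key j j.2 (Fin.lt_def.mp hij).le

lemma pos_of_adj {u v : V} (hu : u ∈ C.verts) (hv : v ∈ C.verts) (h : G.Adj u v) :
    C.pos u = C.pos v ∨ (v ∈ Set.range C.spine ∧
      (C.pos v = C.pos u + 1 ∨ C.pos u = C.pos v + 1)) := by
  by_cases hus : u ∈ Set.range C.spine
  · by_cases hvs : v ∈ Set.range C.spine
    · refine Or.inr ⟨hvs, ?_⟩
      obtain ⟨i, rfl⟩ := hus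
      obtain ⟨j, rfl⟩ := hvs
      rw [C.pos_spine, C.pos_spine]
      rcases lt_trichotomy i j with hij | rfl | hij
      · exact Or.inl (C.spine_adj_le hij h)
      · exact absurd h (G.loopless.irrefl _)
      · exact Or.inr (C.spine_adj_le hij h.symm)
    · left
      rw [C.eq_parent_of_adj hv hvs hu h.symm, C.pos_spine]
  · left
    rw [C.eq_parent_of_adj hu hus hv h, C.pos_spine]

/-- The vertices of the caterpillar whose spine position lies in `[a, b)`. -/
def segment (a b : ℕ) : Set V := {v | v ∈ C.verts ∧ a ≤ C.pos v ∧ C.pos v < b}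

lemma spine_mem_segment {a b : ℕ} {j : Fin C.n} :
    C.spine j ∈ C.segment a b ↔ a ≤ (j : ℕ) ∧ (j : ℕ) < b := by
  simp [segment, C.pos_spine, C.spineMem]

lemma segment_eq_empty {a b : ℕ} (h : b ≤ a) : C.segment a b = ∅ := by
  ext v
  simp only [segment, Set.mem_ofPred_eq, Set.mem_empty_iff_false, iff_false]
  omega

lemma segment_connected {a b : ℕ} (hab : a < b) (hb : b ≤ C.n) :
    (G.induce (C.segment a b)).Connected := by
  have mem : ∀ k (hk : k < C.n), a ≤ k → k < b → C.spine ⟨k, hk⟩ ∈ C.segment a b :=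
    fun k hk h1 h2 => C.spine_mem_segment.mpr ⟨h1, h2⟩
  have ha : a < C.n := by omega
  rw [SimpleGraph.connected_iff_exists_forall_reachable]
  refine ⟨⟨C.spine ⟨a, ha⟩, mem a ha le_rfl hab⟩, ?_⟩
  have key : ∀ k (h1 : a ≤ k) (h2 : k < b), (G.induce (C.segment a b)).Reachable
      ⟨C.spine ⟨a, ha⟩, mem a ha le_rfl hab⟩
      ⟨C.spine ⟨k, by omega⟩, mem k (by omega) h1 h2⟩ := by
    intro k h1
    induction k, h1 using Nat.le_induction with
    | base => exact fun _ => SimpleGraph.Reachable.refl _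
    | succ k h1 ih =>
      intro h2
      refine (ih (by omega)).trans (SimpleGraph.Adj.reachable ?_)
      exact C.spineAdj k (by omega)
  rintro ⟨v, hv, h1, h2⟩
  refine (key _ h1 h2).trans ?_
  rcases C.parent_spec hv with h | h
  · have : (⟨C.spine ⟨C.pos v, C.pos_lt hv⟩, mem _ (C.pos_lt hv) h1 h2⟩ : C.segment a b)
        = ⟨v, hv, h1, h2⟩ := Subtype.ext h
    exact this ▸ SimpleGraph.Reachable.refl _
  · exact SimpleGraph.Adj.reachable (G := G.induce (C.segment a b)) h.2.symm

lemma isCocSetOn_of_segments [Finite V] {A S : Set V} {d : ℕ} (hd : 1 ≤ d) (hA : A ⊆ C.verts)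
    (h : ∀ v (hv : v ∈ A), C.spine ⟨C.pos v, C.pos_lt (hA hv)⟩ ∉ S →
      ∃ a b, a ≤ C.pos v ∧ C.pos v < b ∧ (C.segment a b).ncard ≤ d ∧
        (∀ j : Fin C.n, (j : ℕ) = b → C.spine j ∉ A \ S) ∧
        (∀ j : Fin C.n, (j : ℕ) + 1 = a → C.spine j ∉ A \ S)) :
    IsCocSetOn G A d S := by
  apply isCocSetOn_of_closed
  intro v hv
  by_cases hvS : C.spine ⟨C.pos v, C.pos_lt (hA hv.1)⟩ ∈ S
  · have hvs : v ∉ Set.range C.spine := by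
      rcases C.parent_spec (hA hv.1) with h' | h'
      · exact absurd (h' ▸ hvS) hv.2
      · exact h'.1
    refine ⟨{v}, rfl, by simpa using hd, ?_⟩
    rintro x rfl y hy hxy
    exact absurd (C.eq_parent_of_adj (hA hv.1) hvs (hA hy.1) hxy ▸ hvS) hy.2
  · obtain ⟨a, b, h1, h2, h3, h4, h5⟩ := h v hv.1 hvS
    refine ⟨C.segment a b, ⟨hA hv.1, h1, h2⟩, h3, ?_⟩
    rintro x ⟨hx, hx1, hx2⟩ y hy hxy
    refine ⟨hA hy.1, ?_⟩
    rcases C.pos_of_adj hx (hA hy.1) hxy with he | ⟨⟨j, rfl⟩, he⟩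
    · omega
    · rw [C.pos_spine] at he ⊢
      have hb : (j : ℕ) ≠ b := fun e => h4 j e hy
      have ha : (j : ℕ) + 1 ≠ a := fun e => h5 j e hy
      omega

lemma exists_next_cut (d a : ℕ) :
    ∃ b, a < b ∧ (d + 1 ≤ (C.segment a b).ncard ∨ C.n < b) :=
  ⟨a + C.n + 1, by omega, Or.inr (by omega)⟩

open Classical in
/-- The right end of the shortest segment starting at `a` with more than `d` vertices; if there
is none, a number larger than the length of the spine. -/
noncomputable def nextCut (d a : ℕ) : ℕ := Nat.find (C.exists_next_cut d a)

lemma lt_nextCut (d a : ℕ) : a < C.nextCut d a := by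
  classical exact (Nat.find_spec (C.exists_next_cut d a)).1

lemma lt_ncard_segment_nextCut {d a : ℕ} (h : C.nextCut d a ≤ C.n) :
    d + 1 ≤ (C.segment a (C.nextCut d a)).ncard := by
  classical
  rcases (Nat.find_spec (C.exists_next_cut d a)).2 with h' | h'
  · exact h'
  · exact absurd h (not_le.mpr h')

lemma ncard_segment_le_of_lt_nextCut {d a b : ℕ} (h : b < C.nextCut d a) :
    (C.segment a b).ncard ≤ d := by
  classical
  rcases Nat.lt_or_ge a b with hab | hab
  · have := Nat.find_min (C.exists_next_cut d a) h
    push Not at this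
    have := (this hab).1
    omega
  · simp [C.segment_eq_empty hab]

lemma nextCut_eq [Finite V] {d a m : ℕ} (hm : m < C.n)
    (h1 : d + 1 ≤ (C.segment a (m + 1)).ncard) (h2 : (C.segment a m).ncard ≤ d) :
    C.nextCut d a = m + 1 := by
  classical
  have ham : a < m + 1 := by
    by_contra hle
    simp [C.segment_eq_empty (not_lt.mp hle)] at h1
  have hle : C.nextCut d a ≤ m + 1 := Nat.find_min' _ ⟨ham, Or.inl h1⟩
  refine le_antisymm hle ?_
  by_contra! hlt
  have h3 := C.lt_ncard_segment_nextCut (d := d) (a := a) (by omega)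
  have h4 : C.segment a (C.nextCut d a) ⊆ C.segment a m := by
    rintro v ⟨hv, hv1, hv2⟩
    exact ⟨hv, hv1, by omega⟩
  have := Set.ncard_le_ncard h4 (Set.toFinite _)
  omega

/-- The cut points of the greedy left-to-right packing. -/
noncomputable def cut (d k : ℕ) : ℕ := (C.nextCut d)^[k] 0

lemma cut_zero (d : ℕ) : C.cut d 0 = 0 := rfl

lemma cut_succ (d k : ℕ) : C.cut d (k + 1) = C.nextCut d (C.cut d k) :=
  Function.iterate_succ_apply' _ _ _

lemma cut_strictMono (d : ℕ) : StrictMono (C.cut d) :=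
  strictMono_nat_of_lt_succ fun k => C.cut_succ d k ▸ C.lt_nextCut d _

lemma exists_cut_le_lt (d p : ℕ) : ∃ k, C.cut d k ≤ p ∧ p < C.cut d (k + 1) := by
  induction p with
  | zero => exact ⟨0, le_rfl, (C.cut_strictMono d (Nat.succ_pos 0))⟩
  | succ p ih =>
    obtain ⟨k, h1, h2⟩ := ih
    rcases Nat.lt_or_ge (p + 1) (C.cut d (k + 1)) with h | h
    · exact ⟨k, by omega, h⟩
    · have := C.cut_strictMono d (lt_add_one (k + 1))
      exact ⟨k + 1, h, by omega⟩

open Classical in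
/-- The greedy left-to-right packing. -/
noncomputable def greedyPacking (d : ℕ) : Finset (Set V) :=
  ((Finset.range C.n).filter fun k => C.cut d (k + 1) ≤ C.n).image
    fun k => C.segment (C.cut d k) (C.cut d (k + 1))

lemma mem_greedyPacking {d : ℕ} {A : Set V} : A ∈ C.greedyPacking d ↔
    ∃ k, C.cut d (k + 1) ≤ C.n ∧ C.segment (C.cut d k) (C.cut d (k + 1)) = A := by
  simp only [greedyPacking, Finset.mem_image, Finset.mem_filter, Finset.mem_range, and_assoc]
  refine ⟨fun ⟨k, _, h⟩ => ⟨k, h⟩, fun ⟨k, h⟩ => ⟨k, ?_, h⟩⟩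
  exact ((lt_add_one k).trans_le ((C.cut_strictMono d).le_apply)).trans_le h.1

lemma disjoint_segment_cut {d k l : ℕ} (h : k ≠ l) :
    Disjoint (C.segment (C.cut d k) (C.cut d (k + 1)))
      (C.segment (C.cut d l) (C.cut d (l + 1))) := by
  rw [Set.disjoint_left]
  rintro v ⟨_, h1, h2⟩ ⟨_, h3, h4⟩
  have := (C.cut_strictMono d).lt_iff_lt.mp (h1.trans_lt h4)
  have := (C.cut_strictMono d).lt_iff_lt.mp (h3.trans_lt h2)
  omega

lemma greedyPacking_pieces {d : ℕ} {A : Set V} (hA : A ∈ C.greedyPacking d) :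
    A ⊆ C.verts ∧ d + 1 ≤ A.ncard ∧ (G.induce A).Connected := by
  obtain ⟨k, hk, rfl⟩ := C.mem_greedyPacking.mp hA
  refine ⟨fun v hv => hv.1, ?_, C.segment_connected (C.cut_strictMono d (lt_add_one k)) hk⟩
  rw [C.cut_succ] at hk ⊢
  exact C.lt_ncard_segment_nextCut hk

lemma greedyPacking_pairwise (d : ℕ) :
    (↑(C.greedyPacking d) : Set (Set V)).Pairwise fun A B => Disjoint A B := by
  intro A hA B hB hne
  obtain ⟨k, -, rfl⟩ := C.mem_greedyPacking.mp hA
  obtain ⟨l, -, rfl⟩ := C.mem_greedyPacking.mp hB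
  exact C.disjoint_segment_cut fun h => hne (h ▸ rfl)

lemma exists_isCocSetOn_ncard_le [Finite V] {d : ℕ} (hd : 1 ≤ d) :
    ∃ S ⊆ C.verts, IsCocSetOn G C.verts d S ∧ S.ncard ≤ (C.greedyPacking d).card := by
  classical
  refine ⟨C.spine '' {j | ∃ k, (j : ℕ) + 1 = C.cut d (k + 1)}, ?_, ?_, ?_⟩
  · rintro _ ⟨j, -, rfl⟩
    exact C.spineMem j
  · refine C.isCocSetOn_of_segments hd subset_rfl fun v hv hvS => ?_
    obtain ⟨k, h1, h2⟩ := C.exists_cut_le_lt d (C.pos v)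
    refine ⟨C.cut d k, C.cut d (k + 1) - 1, h1, ?_, ?_, ?_, ?_⟩
    · by_contra hlt
      exact hvS ⟨_, ⟨k, by simp only; omega⟩, rfl⟩
    · apply C.ncard_segment_le_of_lt_nextCut
      rw [← C.cut_succ]
      omega
    · exact fun j hj h => h.2 ⟨j, ⟨k, by omega⟩, rfl⟩
    · intro j hj h
      cases k with
      | zero => rw [C.cut_zero] at hj; omega
      | succ k => exact h.2 ⟨j, ⟨k, hj⟩, rfl⟩
  · rw [Set.ncard_image_of_injective _ C.spineInj, ← Set.ncard_coe_finset]
    have hex : ∀ j : Fin C.n, ∃ k, (∃ k, (j : ℕ) + 1 = C.cut d (k + 1)) →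
        (j : ℕ) + 1 = C.cut d (k + 1) := by
      intro j
      by_cases h : ∃ k, (j : ℕ) + 1 = C.cut d (k + 1)
      · exact h.imp fun _ h _ => h
      · exact ⟨0, fun h' => absurd h' h⟩
    choose f hf using hex
    refine Set.ncard_le_ncard_of_injOn
      (fun j => C.segment (C.cut d (f j)) (C.cut d (f j + 1))) ?_ ?_ (Set.toFinite _)
    · intro j hj
      exact C.mem_greedyPacking.mpr ⟨f j, (hf j hj) ▸ j.2, rfl⟩
    · intro j hj l hl hjl
      have h1 := hf j hj
      have h2 := hf l hl
      by_cases he : f j = f l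
      · rw [he] at h1
        exact Fin.ext (by omega)
      · have hdis := C.disjoint_segment_cut (d := d) he
        have hlt := C.cut_strictMono d (lt_add_one (f j))
        have hmem : C.spine j ∈ C.segment (C.cut d (f j)) (C.cut d (f j + 1)) :=
          C.spine_mem_segment.mpr ⟨by omega, by omega⟩
        have hmem' : C.spine j ∈ C.segment (C.cut d (f l)) (C.cut d (f l + 1)) :=
          (Set.ext_iff.mp hjl _).mp hmem
        exact absurd hmem' (Set.disjoint_left.mp hdis hmem)

lemma card_greedyPacking [Finite V] {d : ℕ} (hd : 1 ≤ d) :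
    (C.greedyPacking d).card = cocOptOn G C.verts d := by
  obtain ⟨S, hS, hcoc, hle⟩ := C.exists_isCocSetOn_ncard_le hd
  have hmem : S.ncard ∈ {m : ℕ | ∃ S : Set V, S ⊆ C.verts ∧ IsCocSetOn G C.verts d S ∧
      S.ncard = m} := ⟨S, hS, hcoc, rfl⟩
  refine le_antisymm ?_ ((Nat.sInf_le hmem).trans hle)
  refine le_csInf ⟨_, hmem⟩ ?_
  rintro _ ⟨T, -, hT, rfl⟩
  exact card_packing_le_ncard hT (fun _ => C.greedyPacking_pieces) (C.greedyPacking_pairwise d)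

lemma exists_covered_spine_bound (d : ℕ) : ∃ i ≤ C.n, ∀ j : Fin C.n,
    ((j : ℕ) < i ↔ ∃ A ∈ C.greedyPacking d, C.spine j ∈ A) := by
  obtain ⟨t, h1, h2⟩ := C.exists_cut_le_lt d C.n
  refine ⟨C.cut d t, h1, fun j => ⟨fun hj => ?_, ?_⟩⟩
  · obtain ⟨k, hk1, hk2⟩ := C.exists_cut_le_lt d j
    have hkt := (C.cut_strictMono d).lt_iff_lt.mp (hk1.trans_lt hj)
    exact ⟨_, C.mem_greedyPacking.mpr
      ⟨k, ((C.cut_strictMono d).monotone (Nat.succ_le_of_lt hkt)).trans h1, rfl⟩,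
      C.spine_mem_segment.mpr ⟨hk1, hk2⟩⟩
  · rintro ⟨A, hA, hjA⟩
    obtain ⟨k, hk, rfl⟩ := C.mem_greedyPacking.mp hA
    have hkt := (C.cut_strictMono d).lt_iff_lt.mp (hk.trans_lt h2)
    exact (C.spine_mem_segment.mp hjA).2.trans_le
      ((C.cut_strictMono d).monotone (Nat.le_of_lt_succ hkt))

lemma isSTP_greedyPacking [Finite V] {d : ℕ} (hd : 1 ≤ d) : IsSTP G d C (C.greedyPacking d) := by
  refine ⟨fun _ => C.greedyPacking_pieces, C.greedyPacking_pairwise d, C.card_greedyPacking hd,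
    ?_, C.exists_covered_spine_bound d, ?_⟩
  · intro A hA v hv hvs w hw hvw
    obtain ⟨k, -, rfl⟩ := C.mem_greedyPacking.mp hA
    have hpos : C.pos v = C.pos w := by
      rw [C.eq_parent_of_adj hv hvs hw.1 hvw, C.pos_spine]
    exact ⟨hv, hpos ▸ hw.2⟩
  · intro A hA j hj hmax
    obtain ⟨k, hk, rfl⟩ := C.mem_greedyPacking.mp hA
    have hlt := C.cut_strictMono d (lt_add_one k)
    have hj' := C.spine_mem_segment.mp hj
    have hmax' := hmax ⟨C.cut d (k + 1) - 1, by omega⟩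
      (C.spine_mem_segment.mpr ⟨by simp only; omega, by simp only; omega⟩)
    simp only at hmax'
    refine C.isCocSetOn_of_segments hd (fun _ h => h.1) fun v hv hvS => ?_
    refine ⟨C.cut d k, j, hv.2.1, ?_, ?_, ?_, ?_⟩
    · by_contra hge
      refine hvS (congrArg C.spine (Fin.ext ?_))
      have := hv.2.2
      simp only
      omega
    · apply C.ncard_segment_le_of_lt_nextCut
      rw [← C.cut_succ]
      exact hj'.2
    · intro l hl h
      exact h.2 (congrArg C.spine (Fin.ext hl))
    · intro l hl h
      have := C.spine_mem_segment.mp h.1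
      omega

end SubCaterpillar

namespace IsSTP

variable {G : SimpleGraph V} {d : ℕ} {C : SubCaterpillar G} {P : Finset (Set V)}

lemma parent_mem (hd : 1 ≤ d) (hP : IsSTP G d C P) {A : Set V} (hA : A ∈ P) {v : V}
    (hvC : v ∈ C.verts) (hv : v ∈ A) : C.spine ⟨C.pos v, C.pos_lt hvC⟩ ∈ A := by
  obtain ⟨hAC, hcard, hconn⟩ := hP.1 A hA
  rcases C.parent_spec hvC with h | h
  · exact h.symm ▸ hv
  · by_contra hno
    have hsub : A ⊆ {v} := by
      refine subset_of_connected_of_closed hconn hv rfl ?_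
      rintro u rfl hu w hw huw
      exact absurd (C.eq_parent_of_adj hvC h.1 (hAC hw) huw ▸ hw) hno
    have := Set.ncard_le_ncard hsub (Set.finite_singleton v)
    rw [Set.ncard_singleton] at this
    omega

lemma mem_of_parent_mem (hP : IsSTP G d C P) {A : Set V} (hA : A ∈ P) {v : V}
    (hvC : v ∈ C.verts) (hv : C.spine ⟨C.pos v, C.pos_lt hvC⟩ ∈ A) : v ∈ A := by
  rcases C.parent_spec hvC with h | h
  · exact h ▸ hv
  · exact hP.2.2.2.1 A hA v hvC h.1 _ hv h.2

lemma exists_eq_segment [Finite V] (hd : 1 ≤ d) (hP : IsSTP G d C P) {A : Set V} (hA : A ∈ P) :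
    ∃ a m, a ≤ m ∧ m < C.n ∧ A = C.segment a (m + 1) ∧ C.nextCut d a = m + 1 := by
  obtain ⟨hAC, hcard, hconn⟩ := hP.1 A hA
  have hne : A.Nonempty := by
    obtain ⟨x⟩ := hconn.nonempty
    exact ⟨x, x.2⟩
  obtain ⟨x, hx, hmin⟩ := Set.exists_min_image A C.pos (Set.toFinite A) hne
  obtain ⟨y, hy, hmax⟩ := Set.exists_max_image A C.pos (Set.toFinite A) hne
  have hyn := C.pos_lt (hAC hy)
  have hxy := hmin y hy
  have hspine : ∀ j (hj : j < C.n), C.pos x ≤ j → j ≤ C.pos y → C.spine ⟨j, hj⟩ ∈ A := by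
    intro j hj hxj hjy
    by_contra hno
    have havoid : ∀ v ∈ A, C.pos v ≠ j := by
      rintro v hv rfl
      exact hno (hP.parent_mem hd hA (hAC hv) hv)
    have hsub : A ⊆ {v | C.pos v < j} := by
      refine subset_of_connected_of_closed hconn hx (lt_of_le_of_ne hxj (havoid x hx)) ?_
      intro u hu huA v hv huv
      have h1 := havoid v hv
      simp only [Set.mem_ofPred_eq] at hu ⊢
      rcases C.pos_of_adj (hAC huA) (hAC hv) huv with h | ⟨-, h⟩ <;> omega
    exact absurd (hsub hy) (not_lt.mpr hjy)
  have hAseg : A = C.segment (C.pos x) (C.pos y + 1) := by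
    ext v
    refine ⟨fun hv => ⟨hAC hv, hmin v hv, Nat.lt_succ_of_le (hmax v hv)⟩, ?_⟩
    rintro ⟨hv, h1, h2⟩
    exact hP.mem_of_parent_mem hA hv (hspine _ _ h1 (Nat.le_of_lt_succ h2))
  refine ⟨C.pos x, C.pos y, hxy, hyn, hAseg, C.nextCut_eq hyn (hAseg ▸ hcard) ?_⟩
  have hcoc := hP.2.2.2.2.2 A hA ⟨C.pos y, hyn⟩ (hspine _ hyn hxy le_rfl)
    fun j hj => C.pos_spine j ▸ hmax _ hj
  rcases Nat.lt_or_ge (C.pos x) (C.pos y) with hlt | hge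
  · refine hcoc.ncard_le ?_ (C.segment_connected hlt hyn.le)
    rintro v ⟨hv, h1, h2⟩
    refine ⟨hAseg ▸ ⟨hv, h1, by omega⟩, ?_⟩
    rintro rfl
    rw [C.pos_spine] at h2
    exact lt_irrefl _ h2
  · simp [C.segment_eq_empty hge]

lemma exists_eq_cut [Finite V] (hd : 1 ≤ d) (hP : IsSTP G d C P) (a : ℕ) :
    ∀ m, a ≤ m → m < C.n → C.segment a (m + 1) ∈ P → ∃ k, C.cut d k = a := by
  induction a using Nat.strong_induction_on with
  | _ a ih =>
    intro m ham hm hmem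
    cases a with
    | zero => exact ⟨0, C.cut_zero d⟩
    | succ a =>
      obtain ⟨i, -, hi⟩ := hP.2.2.2.2.1
      have ha1 : C.spine ⟨a + 1, by omega⟩ ∈ C.segment (a + 1) (m + 1) :=
        C.spine_mem_segment.mpr ⟨le_rfl, by simp only; omega⟩
      have hai : a + 1 < i := (hi ⟨a + 1, by omega⟩).mpr ⟨_, hmem, ha1⟩
      obtain ⟨B, hB, haB⟩ := (hi ⟨a, by omega⟩).mp (by simp only; omega)
      obtain ⟨b, l, hbl, hl, rfl, hcut⟩ := hP.exists_eq_segment hd hB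
      have hab := C.spine_mem_segment.mp haB
      simp only at hab
      have hla : l = a := by
        by_contra hne
        have hmemB : C.spine ⟨a + 1, by omega⟩ ∈ C.segment b (l + 1) :=
          C.spine_mem_segment.mpr ⟨by simp only; omega, by simp only; omega⟩
        have heq : C.segment b (l + 1) = C.segment (a + 1) (m + 1) := by
          by_contra hneq
          exact Set.disjoint_left.mp (hP.2.1 hB hmem hneq) hmemB ha1
        have := C.spine_mem_segment.mp (heq ▸ haB)
        simp only at this
        omega
      obtain ⟨k, hk⟩ := ih b (by omega) l hbl hl hB
      exact ⟨k + 1, by rw [C.cut_succ, hk, hcut, hla]⟩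

lemma eq_greedyPacking [Finite V] (hd : 1 ≤ d) (hP : IsSTP G d C P) : P = C.greedyPacking d := by
  refine Finset.eq_of_subset_of_card_le ?_ (by rw [C.card_greedyPacking hd, hP.2.2.1])
  intro A hA
  obtain ⟨a, m, ham, hm, rfl, hcut⟩ := hP.exists_eq_segment hd hA
  obtain ⟨k, rfl⟩ := hP.exists_eq_cut hd a m ham hm hA
  rw [← C.cut_succ] at hcut
  exact C.mem_greedyPacking.mpr ⟨k, hcut ▸ hm, by rw [hcut]⟩

end IsSTP

/-- Let `d ≥ 1`. Every caterpillar forest (with a fixed spine and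
spine order for each component) has exactly one solution-tight packing. -/
theorem stmt4 {V : Type} [Fintype V] (G : SimpleGraph V) (d : ℕ) (hd : 1 ≤ d)
    (𝔉 : SpinedCatForest G Set.univ) :
    ∃! P : Finset (Set V), IsForestSTP G d 𝔉 P := by
  classical
  refine ⟨Finset.univ.biUnion fun c => (𝔉.comp c).greedyPacking d,
    ⟨fun c => (𝔉.comp c).greedyPacking d, fun c => (𝔉.comp c).isSTP_greedyPacking hd, by simp⟩, ?_⟩
  rintro P ⟨Q, hQ, hPQ⟩
  rw [← Finset.coe_inj, hPQ]
  simp [fun c => (hQ c).eq_greedyPacking hd]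

end CocPaper
end
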